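/- For every planar flat visibility representation of height h of a simple graph G there exists a planar y-monotone poly-line drawing of G of height h in which the y-coordinate of every vertex equals the y-coordinate of its segment in the representation; conversely, for every planar y-monotone poly-line drawing of G of height h there exists a planar flat visibility representation of G of height h in which the y-coordinate of every vertex segment equals the y-coordinate of that vertex in the drawing. -/

import Mathlib

open Set

noncomputable section

/-- Points of the plane. -/
abbrev Pt : Type := ℝ × ℝ

/-- The image (set of points) of a polygonal chain given by its list of breakpoints. -/
def chainSet : List Pt → Set Pt
  | [] => ∅
  | [p] => {p}
  | p :: q :: rest => segment ℝ p q ∪ chainSet (q :: rest)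

/-- The bends (interior junction points) of a polygonal chain. -/
def chainBends (l : List Pt) : List Pt := (l.drop 1).dropLast

/-- `S` is the image of a simple (injective) curve from `a` to `b`. -/
def IsSimpleArc (S : Set Pt) (a b : Pt) : Prop :=
  ∃ γ : ℝ → Pt, ContinuousOn γ (Icc (0:ℝ) 1) ∧ InjOn γ (Icc (0:ℝ) 1) ∧
    γ '' Icc (0:ℝ) 1 = S ∧ γ 0 = a ∧ γ 1 = b

/-- A poly-line drawing of a simple graph `G`: an injective placement of the vertices
together with, for each edge, a simple polygonal arc joining the endpoints. -/
structure PolyDrawing {V : Type} (G : SimpleGraph V) where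
  pos : V → Pt
  pos_inj : Function.Injective pos
  arc : Sym2 V → List Pt
  arc_ends : ∀ u v : V, G.Adj u v →
    ((arc s(u, v)).head? = some (pos u) ∧ (arc s(u, v)).getLast? = some (pos v)) ∨
    ((arc s(u, v)).head? = some (pos v) ∧ (arc s(u, v)).getLast? = some (pos u))
  arc_simple : ∀ u v : V, G.Adj u v →
    IsSimpleArc (chainSet (arc s(u, v))) (pos u) (pos v)

namespace PolyDrawing

variable {V : Type} {G : SimpleGraph V}

/-- The set of points used by the arc of an edge. -/
def edgePts (Γ : PolyDrawing G) (e : Sym2 V) : Set Pt := chainSet (Γ.arc e)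

/-- Planarity: no vertex point lies on the arc of a non-incident edge, and arcs of
distinct edges meet only in images of common endpoints. -/
def IsPlanar (Γ : PolyDrawing G) : Prop :=
  (∀ v : V, ∀ e ∈ G.edgeSet, v ∉ e → Γ.pos v ∉ Γ.edgePts e) ∧
  (∀ e ∈ G.edgeSet, ∀ f ∈ G.edgeSet, e ≠ f →
    ∀ p ∈ Γ.edgePts e ∩ Γ.edgePts f, ∃ w : V, w ∈ e ∧ w ∈ f ∧ p = Γ.pos w)

/-- `y`-monotone: along every edge arc the `y`-coordinate varies weakly monotonically. -/
def IsYMonotone (Γ : PolyDrawing G) : Prop :=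
  ∀ e ∈ G.edgeSet,
    List.Chain' (· ≤ ·) ((Γ.arc e).map Prod.snd) ∨
    List.Chain' (· ≥ ·) ((Γ.arc e).map Prod.snd)

/-- The drawing has height `h`: every vertex and every bend has an integer
`y`-coordinate in `{1, …, h}`. -/
def HasHeight (Γ : PolyDrawing G) (h : ℕ) : Prop :=
  (∀ v : V, ∃ k : ℤ, 1 ≤ k ∧ k ≤ (h : ℤ) ∧ (Γ.pos v).2 = (k : ℝ)) ∧
  (∀ e ∈ G.edgeSet, ∀ p ∈ chainBends (Γ.arc e), ∃ k : ℤ, 1 ≤ k ∧ k ≤ (h : ℤ) ∧ p.2 = (k : ℝ))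

/-- All vertices and bends have integer `y`-coordinates. -/
def IntegerY (Γ : PolyDrawing G) : Prop :=
  (∀ v : V, ∃ k : ℤ, (Γ.pos v).2 = (k : ℝ)) ∧
  (∀ e ∈ G.edgeSet, ∀ p ∈ chainBends (Γ.arc e), ∃ k : ℤ, p.2 = (k : ℝ))

/-- The set of all points of the drawing (vertex points and edge arcs). -/
def image (Γ : PolyDrawing G) : Set Pt :=
  Set.range Γ.pos ∪ ⋃ e ∈ G.edgeSet, Γ.edgePts e

/-- The union of the unbounded connected components of the complement of the drawing. -/
def outerRegion (Γ : PolyDrawing G) : Set Pt :=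
  {p | p ∉ Γ.image ∧ ¬ Bornology.IsBounded (connectedComponentIn Γ.imageᶜ p)}

/-- A vertex is inner if its point does not lie on the boundary of the unbounded
connected component of the complement of the drawing. -/
def IsInner (Γ : PolyDrawing G) (v : V) : Prop :=
  Γ.pos v ∉ frontier Γ.outerRegion

/-- Number of incoming edges at `v` (edges whose other endpoint is weakly below `v`;
horizontal edges count as incoming). -/
def indeg (Γ : PolyDrawing G) (v : V) : ℕ :=
  {w : V | G.Adj v w ∧ (Γ.pos w).2 ≤ (Γ.pos v).2}.ncard

/-- Number of outgoing edges at `v` (edges whose other endpoint is weakly above `v`;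
horizontal edges count as outgoing). -/
def outdeg (Γ : PolyDrawing G) (v : V) : ℕ :=
  {w : V | G.Adj v w ∧ (Γ.pos v).2 ≤ (Γ.pos w).2}.ncard

/-- The set of points drawn for an element (vertex or edge) of the graph. -/
def drawSet (Γ : PolyDrawing G) : V ⊕ ↥G.edgeSet → Set Pt
  | Sum.inl v => {Γ.pos v}
  | Sum.inr e => Γ.edgePts e

end PolyDrawing

/-- A straight-line drawing of a simple graph: an injective placement of the vertices;
each edge is drawn as the closed segment between its endpoints. -/
structure StraightDrawing {V : Type} (G : SimpleGraph V) where
  pos : V → Pt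
  pos_inj : Function.Injective pos

namespace StraightDrawing

variable {V : Type} {G : SimpleGraph V}

/-- The closed segment representing an edge. -/
def edgePts (Γ : StraightDrawing G) (e : Sym2 V) : Set Pt :=
  Sym2.lift ⟨fun u v => segment ℝ (Γ.pos u) (Γ.pos v),
    fun u v => segment_symm (𝕜 := ℝ) (Γ.pos u) (Γ.pos v)⟩ e

/-- Planarity of a straight-line drawing. -/
def IsPlanar (Γ : StraightDrawing G) : Prop :=
  (∀ v : V, ∀ e ∈ G.edgeSet, v ∉ e → Γ.pos v ∉ Γ.edgePts e) ∧
  (∀ e ∈ G.edgeSet, ∀ f ∈ G.edgeSet, e ≠ f →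
    ∀ p ∈ Γ.edgePts e ∩ Γ.edgePts f, ∃ w : V, w ∈ e ∧ w ∈ f ∧ p = Γ.pos w)

/-- Every vertex has an integer `y`-coordinate in `{1, …, h}`. -/
def HeightLe (Γ : StraightDrawing G) (h : ℕ) : Prop :=
  ∀ v : V, ∃ k : ℤ, 1 ≤ k ∧ k ≤ (h : ℤ) ∧ (Γ.pos v).2 = (k : ℝ)

/-- All vertices lie on integer grid points. -/
def IsGrid (Γ : StraightDrawing G) : Prop :=
  ∀ v : V, ∃ p : ℤ × ℤ, Γ.pos v = ((p.1 : ℝ), (p.2 : ℝ))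

/-- The set of points drawn for an element (vertex or edge) of the graph. -/
def drawSet (Γ : StraightDrawing G) : V ⊕ ↥G.edgeSet → Set Pt
  | Sum.inl v => {Γ.pos v}
  | Sum.inr e => Γ.edgePts e

end StraightDrawing

/-- The intersection of a set of points with the horizontal line `y = r`,
recorded as a set of `x`-coordinates. -/
def rowSlice (S : Set Pt) (r : ℝ) : Set ℝ := {x : ℝ | (x, r) ∈ S}

/-- Two drawings (given by the sets drawn for each vertex/edge element) have the same
left-to-right order in each row: for every integer row `r` and elements `a`, `b` both
meeting row `r` in both drawings, the drawing of `a` lies entirely strictly to the left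
of that of `b` in one drawing iff it does in the other. -/
def SameRowOrder {α : Type} (D D' : α → Set Pt) : Prop :=
  ∀ r : ℤ, ∀ a b : α,
    (rowSlice (D a) (r : ℝ)).Nonempty → (rowSlice (D b) (r : ℝ)).Nonempty →
    (rowSlice (D' a) (r : ℝ)).Nonempty → (rowSlice (D' b) (r : ℝ)).Nonempty →
    ((∀ x ∈ rowSlice (D a) (r : ℝ), ∀ y ∈ rowSlice (D b) (r : ℝ), x < y) ↔
     (∀ x ∈ rowSlice (D' a) (r : ℝ), ∀ y ∈ rowSlice (D' b) (r : ℝ), x < y))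

/-- A simple graph on `n ≥ 3` vertices is triangulated (maximal planar) if it admits a
planar poly-line drawing and has exactly `3n - 6` edges. -/
def IsTriangulated {V : Type} [Fintype V] (G : SimpleGraph V) : Prop :=
  3 ≤ Fintype.card V ∧ G.edgeSet.ncard = 3 * Fintype.card V - 6 ∧
  ∃ Γ : PolyDrawing G, Γ.IsPlanar

/-- Data of a flat visibility representation: a horizontal segment for every vertex
(given by its `y`-coordinate and left/right `x`-coordinates) and a segment (given by
its two endpoints) for every edge. -/
structure VisData (V : Type) where
  ly : V → ℝ
  lx : V → ℝ
  rx : V → ℝ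
  ep1 : Sym2 V → Pt
  ep2 : Sym2 V → Pt

/-- The horizontal segment of a vertex. -/
def VisData.vseg {V : Type} (D : VisData V) (v : V) : Set Pt :=
  segment ℝ (D.lx v, D.ly v) (D.rx v, D.ly v)

/-- The segment of an edge. -/
def VisData.eseg {V : Type} (D : VisData V) (e : Sym2 V) : Set Pt :=
  segment ℝ (D.ep1 e) (D.ep2 e)

/-- `D` is a planar flat visibility representation of `G` of height `h`. -/
def IsFlatVisRep {V : Type} (G : SimpleGraph V) (D : VisData V) (h : ℕ) : Prop :=
  (∀ v : V, D.lx v ≤ D.rx v) ∧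
  (∀ v : V, ∃ k : ℤ, 1 ≤ k ∧ k ≤ (h : ℤ) ∧ D.ly v = (k : ℝ)) ∧
  (∀ e ∈ G.edgeSet, (D.ep1 e).1 = (D.ep2 e).1 ∨ (D.ep1 e).2 = (D.ep2 e).2) ∧
  (∀ e ∈ G.edgeSet, ∀ p ∈ D.eseg e, 1 ≤ p.2 ∧ p.2 ≤ (h : ℝ)) ∧
  (∀ u v : V, G.Adj u v →
    (D.ep1 s(u, v) ∈ D.vseg u ∧ D.ep2 s(u, v) ∈ D.vseg v) ∨
    (D.ep1 s(u, v) ∈ D.vseg v ∧ D.ep2 s(u, v) ∈ D.vseg u)) ∧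
  (∀ u v : V, u ≠ v → Disjoint (D.vseg u) (D.vseg v)) ∧
  (∀ e ∈ G.edgeSet, ∀ w : V, ∀ p ∈ D.eseg e ∩ D.vseg w, p = D.ep1 e ∨ p = D.ep2 e) ∧
  (∀ e ∈ G.edgeSet, ∀ f ∈ G.edgeSet, e ≠ f → ∀ p ∈ D.eseg e ∩ D.eseg f,
    (p = D.ep1 e ∨ p = D.ep2 e) ∧ (p = D.ep1 f ∨ p = D.ep2 f))

end

/-- Combinatorial record of a drawing by rows: the row and abscissa of every vertex, an
orientation of the edges, an abscissa `cross k e` for every edge in every row `k`, and an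
abscissa `mid k e` for every edge strictly between the rows `k` and `k + 1`. -/
structure RowData (V : Type) where
  row : V → ℕ
  xpos : V → ℝ
  bot : Sym2 V → V
  top : Sym2 V → V
  cross : ℕ → Sym2 V → ℝ
  mid : ℕ → Sym2 V → ℝ

/-- The non-horizontal edge `e` meets row `k`. -/
structure RowData.Meets {V : Type} (L : RowData V) (G : SimpleGraph V) (k : ℕ)
    (e : Sym2 V) : Prop where
  mem : e ∈ G.edgeSet
  lt : L.row (L.bot e) < L.row (L.top e)
  bot_le : L.row (L.bot e) ≤ k
  le_top : k ≤ L.row (L.top e)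

/-- The conditions under which row data describes a planar drawing of `G` of height `h`. -/
structure RowData.IsLayout {V : Type} (L : RowData V) (G : SimpleGraph V) (h : ℕ) : Prop where
  one_le_row : ∀ v, 1 ≤ L.row v
  row_le : ∀ v, L.row v ≤ h
  eq_mk : ∀ e ∈ G.edgeSet, e = s(L.bot e, L.top e)
  bot_le_top : ∀ e ∈ G.edgeSet, L.row (L.bot e) ≤ L.row (L.top e)
  xpos_inj : ∀ u v, L.row u = L.row v → L.xpos u = L.xpos v → u = v
  cross_bot : ∀ e k, L.Meets G k e → L.row (L.bot e) = k → L.cross k e = L.xpos (L.bot e)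
  cross_top : ∀ e k, L.Meets G k e → L.row (L.top e) = k → L.cross k e = L.xpos (L.top e)
  cross_eq : ∀ e f k, L.Meets G k e → L.Meets G k f → e ≠ f → L.cross k e = L.cross k f →
    ∃ w, w ∈ e ∧ w ∈ f ∧ L.row w = k
  cross_eq_xpos : ∀ e k v, L.Meets G k e → L.row v = k → L.cross k e = L.xpos v → v ∈ e
  mid_ne : ∀ e f k, L.Meets G k e → L.Meets G k f → L.Meets G (k + 1) e →
    L.Meets G (k + 1) f → e ≠ f → L.mid k e ≠ L.mid k f
  mid_lt : ∀ e f k, L.Meets G k e → L.Meets G k f → L.Meets G (k + 1) e →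
    L.Meets G (k + 1) f → L.mid k e < L.mid k f →
    L.cross k e ≤ L.cross k f ∧ L.cross (k + 1) e ≤ L.cross (k + 1) f
  hor_lt : ∀ e ∈ G.edgeSet, L.row (L.bot e) = L.row (L.top e) →
    L.xpos (L.bot e) < L.xpos (L.top e)
  hor_vert : ∀ e ∈ G.edgeSet, L.row (L.bot e) = L.row (L.top e) → ∀ v,
    L.row v = L.row (L.bot e) → L.xpos (L.bot e) ≤ L.xpos v → L.xpos v ≤ L.xpos (L.top e) → v ∈ e
  hor_cross : ∀ e ∈ G.edgeSet, L.row (L.bot e) = L.row (L.top e) → ∀ f,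
    L.Meets G (L.row (L.bot e)) f → L.xpos (L.bot e) ≤ L.cross (L.row (L.bot e)) f →
    L.cross (L.row (L.bot e)) f ≤ L.xpos (L.top e) → ∃ w, w ∈ e ∧ w ∈ f

/-- A strictly monotone real labelling of a subset of a finite set extends to the set. -/
theorem exists_strictMono_extension {α K : Type} [LinearOrder K] (key : α → K) (x : α → ℝ)
    (C : Set α) (hx : ∀ a ∈ C, ∀ b ∈ C, key a < key b → x a < x b)
    (S : Finset α) (hC : C.Finite) :
    ∃ x' : α → ℝ, (∀ a, a ∉ (S : Set α) \ C → x' a = x a) ∧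
      ∀ a ∈ C ∪ S, ∀ b ∈ C ∪ S, key a < key b → x' a < x' b := by
  classical
  induction S using Finset.induction_on with
  | empty => exact ⟨x, fun _ _ => rfl, by simpa using hx⟩
  | insert c S hc ih =>
    obtain ⟨x', h1, h2⟩ := ih
    by_cases hcC : c ∈ C
    · refine ⟨x', fun a ha => h1 a (by simp at ha ⊢; tauto), fun a ha b hb => h2 a ?_ b ?_⟩
      · rcases ha with h | h
        · exact Or.inl h
        · rcases Finset.mem_insert.1 h with rfl | h
          · exact Or.inl hcC
          · exact Or.inr h
      · rcases hb with h | h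
        · exact Or.inl h
        · rcases Finset.mem_insert.1 h with rfl | h
          · exact Or.inl hcC
          · exact Or.inr h
    have hT : (C ∪ (S : Set α)).Finite := hC.union S.finite_toSet
    let T := hT.toFinset
    obtain ⟨m, hm1, hm2⟩ := Order.exists_between_finsets
      ((T.filter (fun a => key a < key c)).image x') ((T.filter (fun a => key c < key a)).image x')
      (by
        simp only [Finset.mem_image, Finset.mem_filter]
        rintro _ ⟨a, ⟨ha, ha'⟩, rfl⟩ _ ⟨b, ⟨hb, hb'⟩, rfl⟩
        exact h2 a (by simpa [T] using ha) b (by simpa [T] using hb) (ha'.trans hb'))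
    have hcT : c ∉ C ∪ (S : Set α) := by simp [hcC, hc]
    have key' : ∀ a ∈ C ∪ (↑(insert c S) : Set α), a = c ∨ a ∈ C ∪ (S : Set α) := by
      intro a; simp
    refine ⟨Function.update x' c m, ?_, ?_⟩
    · intro a ha
      have hac : a ≠ c := by rintro rfl; simp [hcC] at ha
      rw [Function.update_of_ne hac]
      exact h1 a (by simp at ha ⊢; tauto)
    · intro a ha b hb hab
      rcases key' a ha with rfl | ha'
      · rcases key' b hb with rfl | hb'
        · exact absurd hab (lt_irrefl _)
        · rw [Function.update_self, Function.update_of_ne (by rintro rfl; exact hcT hb')]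
          exact hm2 _ (Finset.mem_image_of_mem _ (by simpa [T, hab] using hb'))
      · rw [Function.update_of_ne (by rintro rfl; exact hcT ha')]
        rcases key' b hb with rfl | hb'
        · rw [Function.update_self]
          exact hm1 _ (Finset.mem_image_of_mem _ (by simpa [T, hab] using ha'))
        · rw [Function.update_of_ne (by rintro rfl; exact hcT hb')]
          exact h2 a ha' b hb' hab

/-- Compatible linear orders on a sequence of finite sets, in which every element occurs in
consecutive sets only, are induced by a single real labelling. -/
theorem exists_common_labelling {α K : Type} [Finite α] [LinearOrder K] (B : ℕ → Set α)
    (key : ℕ → α → K)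
    (hconv : ∀ i j k a, i ≤ k → k ≤ j → a ∈ B i → a ∈ B j → a ∈ B k)
    (hcomp : ∀ k a b, a ∈ B k → b ∈ B k → a ∈ B (k + 1) → b ∈ B (k + 1) →
      key (k + 1) a < key (k + 1) b → key k a < key k b) (n : ℕ) :
    ∃ x : α → ℝ, ∀ k ≤ n, ∀ a ∈ B k, ∀ b ∈ B k, key k a < key k b → x a < x b := by
  classical
  induction n with
  | zero =>
    obtain ⟨x, -, hx⟩ := exists_strictMono_extension (key 0) (fun _ => 0) ∅ (by simp)
      (toFinite (B 0)).toFinset finite_empty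
    refine ⟨x, fun k hk => ?_⟩
    obtain rfl : k = 0 := by omega
    simpa using hx
  | succ n ih =>
    obtain ⟨x, hx⟩ := ih
    have hU : (B n ∩ B (n + 1)) ∪ B (n + 1) = B (n + 1) := union_eq_right.2 inter_subset_right
    obtain ⟨x', h1, h2⟩ := exists_strictMono_extension (key (n + 1)) x (B n ∩ B (n + 1))
      (fun a ha b hb hab => hx n le_rfl a ha.1 b hb.1 (hcomp n a b ha.1 hb.1 ha.2 hb.2 hab))
      (toFinite (B (n + 1))).toFinset (toFinite _)
    simp only [Finite.coe_toFinset, hU] at h1 h2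
    refine ⟨x', fun k hk a ha b hb hab => ?_⟩
    rcases Nat.lt_or_ge n k with h | h
    · obtain rfl : k = n + 1 := by omega
      exact h2 a ha b hb hab
    · have aux : ∀ c ∈ B k, x' c = x c := fun c hc => h1 c fun hc' =>
        hc'.2 ⟨hconv k (n + 1) n c h (by omega) hc hc'.1, hc'.1⟩
      rw [aux a ha, aux b hb]
      exact hx k h a ha b hb hab

namespace RowData.IsLayout

variable {V : Type} {L : RowData V} {G : SimpleGraph V} {h : ℕ}

theorem mem_iff (hL : L.IsLayout G h) {e : Sym2 V} (he : e ∈ G.edgeSet) {w : V} :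
    w ∈ e ↔ w = L.bot e ∨ w = L.top e := by
  conv_lhs => rw [hL.eq_mk e he]
  exact Sym2.mem_iff

theorem cross_of_mem (hL : L.IsLayout G h) {e : Sym2 V} {k : ℕ} (he : L.Meets G k e) {w : V}
    (hw : w ∈ e) (hk : L.row w = k) : L.cross k e = L.xpos w := by
  rcases (hL.mem_iff he.mem).1 hw with rfl | rfl
  · exact hL.cross_bot e k he hk
  · exact hL.cross_top e k he hk

theorem meets_of_mem (hL : L.IsLayout G h) {e : Sym2 V} (he : e ∈ G.edgeSet)
    (hlt : L.row (L.bot e) < L.row (L.top e)) {w : V} (hw : w ∈ e) : L.Meets G (L.row w) e := by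
  rcases (hL.mem_iff he).1 hw with rfl | rfl
  · exact ⟨he, hlt, le_rfl, hlt.le⟩
  · exact ⟨he, hlt, hlt.le, le_rfl⟩

theorem bot_ne_top (hL : L.IsLayout G h) {e : Sym2 V} (he : e ∈ G.edgeSet) :
    L.bot e ≠ L.top e := by
  have h1 := hL.eq_mk e he
  rw [h1, SimpleGraph.mem_edgeSet] at he
  exact he.ne

/-- Two distinct horizontal edges in the same row overlap at most in a common end. -/
theorem hor_hor (hL : L.IsLayout G h) {e f : Sym2 V} (he : e ∈ G.edgeSet) (hf : f ∈ G.edgeSet)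
    (hef : e ≠ f) (he' : L.row (L.bot e) = L.row (L.top e))
    (hf' : L.row (L.bot f) = L.row (L.top f)) (hrow : L.row (L.bot e) = L.row (L.bot f)) {x : ℝ}
    (h1 : L.xpos (L.bot e) ≤ x) (h2 : x ≤ L.xpos (L.top e))
    (h3 : L.xpos (L.bot f) ≤ x) (h4 : x ≤ L.xpos (L.top f)) :
    (L.bot f = L.top e ∨ L.bot e = L.top f) ∧ ∃ w, w ∈ e ∧ w ∈ f ∧ x = L.xpos w := by
  have hbb : L.bot e ≠ L.bot f := by
    intro hb
    have hne : L.top e ≠ L.top f := fun ht => hef (by rw [hL.eq_mk e he, hL.eq_mk f hf, hb, ht])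
    rcases le_total (L.xpos (L.top e)) (L.xpos (L.top f)) with h | h
    · rcases (hL.mem_iff hf).1
        (hL.hor_vert f hf hf' (L.top e) (by omega) (by linarith) h) with h | h
      · exact hL.bot_ne_top he (hb.trans h.symm)
      · exact hne h
    · rcases (hL.mem_iff he).1
        (hL.hor_vert e he he' (L.top f) (by omega) (by linarith) h) with h | h
      · exact hL.bot_ne_top hf (hb.symm.trans h.symm)
      · exact hne h.symm
  rcases le_total (L.xpos (L.bot e)) (L.xpos (L.bot f)) with h | h
  · have := hL.hor_vert e he he' (L.bot f) hrow.symm h (by linarith)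
    rcases (hL.mem_iff he).1 this with h | h
    · exact absurd h.symm hbb
    · refine ⟨Or.inl h, L.bot f, this, (hL.mem_iff hf).2 (Or.inl rfl), ?_⟩
      rw [← h] at h2; linarith
  · have := hL.hor_vert f hf hf' (L.bot e) hrow h (by linarith)
    rcases (hL.mem_iff hf).1 this with h | h
    · exact absurd h hbb
    · refine ⟨Or.inr h, L.bot e, (hL.mem_iff he).2 (Or.inl rfl), this, ?_⟩
      rw [← h] at h4; linarith

end RowData.IsLayout

namespace RowData

variable {V : Type} (L : RowData V) (G : SimpleGraph V)

/-- The vertices and non-horizontal edges that meet row `k`. -/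
def active (k : ℕ) : Set (V ⊕ Sym2 V) :=
  {a | Sum.elim (fun v => L.row v = k) (fun e => L.Meets G k e) a}

/-- The abscissa of a vertex or edge in row `k`. -/
def abscissa (k : ℕ) : V ⊕ Sym2 V → ℝ := Sum.elim L.xpos (L.cross k)

/-- The sort key of row `k`: items are ordered by abscissa; at a vertex, edges from below come
first and edges to above come last, both ordered by their position off the row. -/
def sortKey (k : ℕ) : V ⊕ Sym2 V → ℝ ×ₗ (ℝ ×ₗ ℝ) :=
  Sum.elim (fun v => toLex (L.xpos v, toLex (0, 0)))
    (fun e => toLex (L.cross k e,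
      if L.row (L.top e) = k then toLex (-1, L.mid (k - 1) e) else toLex (1, L.mid k e)))

variable {L G} {h : ℕ}

theorem sortKey_lt_of_abscissa_lt {k : ℕ} {a b : V ⊕ Sym2 V}
    (hab : L.abscissa k a < L.abscissa k b) : L.sortKey k a < L.sortKey k b := by
  rcases a with a | a <;> rcases b with b | b <;>
    simp only [sortKey, abscissa, Sum.elim_inl, Sum.elim_inr] at hab ⊢ <;>
    exact Prod.Lex.toLex_lt_toLex.2 (Or.inl hab)

namespace IsLayout

theorem sortKey_lt_of_mid_lt (hL : L.IsLayout G h) {k : ℕ} {e f : Sym2 V} (he : L.Meets G k e)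
    (hf : L.Meets G k f) (he' : L.Meets G (k + 1) e) (hf' : L.Meets G (k + 1) f)
    (hlt : L.mid k e < L.mid k f) :
    L.sortKey k (Sum.inr e) < L.sortKey k (Sum.inr f) ∧
      L.sortKey (k + 1) (Sum.inr e) < L.sortKey (k + 1) (Sum.inr f) := by
  obtain ⟨h1, h2⟩ := hL.mid_lt e f k he hf he' hf' hlt
  have hef : e ≠ f := by rintro rfl; exact lt_irrefl _ hlt
  have e1 := he'.le_top
  have f1 := hf'.le_top
  have e2 := he.bot_le
  have f2 := hf.bot_le
  constructor
  · simp only [sortKey, Sum.elim_inr]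
    rw [if_neg (by omega), if_neg (by omega)]
    rcases h1.lt_or_eq with h1 | h1
    · exact Prod.Lex.toLex_lt_toLex.2 (Or.inl h1)
    · exact Prod.Lex.toLex_lt_toLex.2 (Or.inr ⟨h1, Prod.Lex.toLex_lt_toLex.2 (Or.inr ⟨rfl, hlt⟩)⟩)
  · simp only [sortKey, Sum.elim_inr]
    rcases h2.lt_or_eq with h2 | h2
    · exact Prod.Lex.toLex_lt_toLex.2 (Or.inl h2)
    · refine Prod.Lex.toLex_lt_toLex.2 (Or.inr ⟨h2, ?_⟩)
      obtain ⟨w, hwe, hwf, hw⟩ := hL.cross_eq e f _ he' hf' hef h2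
      have aux : ∀ g, L.Meets G k g → w ∈ g → L.row (L.top g) = k + 1 := by
        intro g hg hwg
        have := hg.bot_le
        rcases (hL.mem_iff hg.mem).1 hwg with rfl | rfl <;> omega
      rw [if_pos (aux e he hwe), if_pos (aux f hf hwf)]
      exact Prod.Lex.toLex_lt_toLex.2 (Or.inr ⟨rfl, hlt⟩)

theorem sortKey_ne (hL : L.IsLayout G h) {k : ℕ} {e f : Sym2 V} (he : L.Meets G k e)
    (hf : L.Meets G k f) (hef : e ≠ f) :
    L.sortKey k (Sum.inr e) ≠ L.sortKey k (Sum.inr f) := by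
  intro heq
  simp only [sortKey, Sum.elim_inr, toLex_inj, Prod.mk.injEq] at heq
  obtain ⟨hc, heq⟩ := heq
  obtain ⟨w, hwe, hwf, hw⟩ := hL.cross_eq e f _ he hf hef hc
  have hlt := he.lt
  have hlt' := hf.lt
  have h1 := he.bot_le
  have h2 := hf.bot_le
  have h3 := he.le_top
  have h4 := hf.le_top
  split_ifs at heq with h5 h6 h6
  · simp only [toLex_inj, Prod.mk.injEq, true_and] at heq
    obtain ⟨j, rfl⟩ : ∃ j, k = j + 1 := ⟨k - 1, by omega⟩
    exact hL.mid_ne e f j ⟨he.mem, hlt, by omega, by omega⟩ ⟨hf.mem, hlt', by omega, by omega⟩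
      he hf hef heq
  · simp only [toLex_inj, Prod.mk.injEq] at heq
    norm_num at heq
  · simp only [toLex_inj, Prod.mk.injEq] at heq
    norm_num at heq
  · simp only [toLex_inj, Prod.mk.injEq, true_and] at heq
    exact hL.mid_ne e f k he hf ⟨he.mem, hlt, by omega, by omega⟩
      ⟨hf.mem, hlt', by omega, by omega⟩ hef heq

/-- The vertices and non-horizontal edges of a layout can be labelled by reals in a way that
respects the left-to-right order of every row. -/
theorem exists_labelling [Finite V] (hL : L.IsLayout G h) :
    ∃ x : V ⊕ Sym2 V → ℝ,
      (∀ k, ∀ a ∈ L.active G k, ∀ b ∈ L.active G k, L.abscissa k a < L.abscissa k b → x a < x b) ∧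
      ∀ k e f, L.Meets G k e → L.Meets G k f → e ≠ f → x (Sum.inr e) ≠ x (Sum.inr f) := by
  have hact : ∀ k, ∀ a ∈ L.active G k, k ≤ h := by
    rintro k (v | e) ha
    · exact le_of_eq_of_le (Eq.symm ha) (hL.row_le v)
    · exact (RowData.Meets.le_top ha).trans (hL.row_le _)
  obtain ⟨x, hx⟩ := exists_common_labelling (L.active G) L.sortKey
    (by
      rintro i j k (v | e) hik hkj hi hj
      · simp only [active, mem_ofPred_eq, Sum.elim_inl] at hi hj ⊢
        omega
      · exact ⟨Meets.mem hi, Meets.lt hi, (Meets.bot_le hi).trans hik,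
          hkj.trans (Meets.le_top hj)⟩)
    (by
      rintro k (u | e) (v | f) ha hb ha' hb' hlt
      all_goals simp only [active, mem_ofPred_eq, Sum.elim_inl, Sum.elim_inr] at ha hb ha' hb'
      · omega
      · omega
      · omega
      · have hef : e ≠ f := by rintro rfl; exact lt_irrefl _ hlt
        rcases lt_or_gt_of_ne (hL.mid_ne e f k ha hb ha' hb' hef) with hm | hm
        · exact (hL.sortKey_lt_of_mid_lt ha hb ha' hb' hm).1
        · exact absurd hlt (hL.sortKey_lt_of_mid_lt hb ha hb' ha' hm).2.asymm) h
  refine ⟨x, fun k a ha b hb hab => hx k (hact k a ha) a ha b hb (sortKey_lt_of_abscissa_lt hab),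
    fun k e f he hf hef => ?_⟩
  have hk := hact k (Sum.inr e) he
  rcases lt_or_gt_of_ne (hL.sortKey_ne he hf hef) with hlt | hlt
  · exact (hx k hk _ he _ hf hlt).ne
  · exact (hx k hk _ hf _ he hlt).ne'

end IsLayout

/-- A vertex together with the non-horizontal edges at it. -/
def star (L : RowData V) (G : SimpleGraph V) (v : V) : Set (V ⊕ Sym2 V) :=
  {a | a = Sum.inl v ∨ ∃ e, a = Sum.inr e ∧ v ∈ e ∧ L.Meets G (L.row v) e}

namespace IsLayout

theorem active_of_mem_star {v : V} {a : V ⊕ Sym2 V} (ha : a ∈ L.star G v) :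
    a ∈ L.active G (L.row v) := by
  rcases ha with rfl | ⟨e, rfl, -, he⟩
  · rfl
  · exact he

theorem abscissa_of_mem_star (hL : L.IsLayout G h) {v : V} {a : V ⊕ Sym2 V}
    (ha : a ∈ L.star G v) : L.abscissa (L.row v) a = L.xpos v := by
  rcases ha with rfl | ⟨e, rfl, hv, he⟩
  · rfl
  · exact hL.cross_of_mem he hv rfl

end IsLayout

end RowData

theorem mem_segment_snd_eq {a b y : ℝ} (hab : a ≤ b) {p : Pt} :
    p ∈ segment ℝ ((a, y) : Pt) (b, y) ↔ p.2 = y ∧ a ≤ p.1 ∧ p.1 ≤ b := by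
  obtain ⟨p1, p2⟩ := p
  rw [← Prod.image_mk_segment_left, segment_eq_Icc hab]
  simp only [mem_image, mem_Icc, Prod.mk.injEq]
  constructor
  · rintro ⟨x, hx, rfl, rfl⟩; exact ⟨rfl, hx⟩
  · rintro ⟨rfl, hx⟩; exact ⟨p1, hx, rfl, rfl⟩

theorem mem_segment_fst_eq {a b x : ℝ} (hab : a ≤ b) {p : Pt} :
    p ∈ segment ℝ ((x, a) : Pt) (x, b) ↔ p.1 = x ∧ a ≤ p.2 ∧ p.2 ≤ b := by
  obtain ⟨p1, p2⟩ := p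
  rw [← Prod.image_mk_segment_right, segment_eq_Icc hab]
  simp only [mem_image, mem_Icc, Prod.mk.injEq]
  constructor
  · rintro ⟨x, hx, rfl, rfl⟩; exact ⟨rfl, hx⟩
  · rintro ⟨rfl, hx⟩; exact ⟨p2, hx, rfl, rfl⟩

open Classical in
/-- Every layout is realised by a flat visibility representation. -/
theorem RowData.IsLayout.exists_flatVisRep {V : Type} [Finite V] {L : RowData V}
    {G : SimpleGraph V} {h : ℕ} (hL : L.IsLayout G h) :
    ∃ D : VisData V, IsFlatVisRep G D h ∧ ∀ v, D.ly v = L.row v := by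
  obtain ⟨x, hmono, hne⟩ := hL.exists_labelling
  have hstar : ∀ v, Sum.inl v ∈ L.star G v := fun v => Or.inl rfl
  choose lo hlo hlo' using fun v => (toFinite (L.star G v)).exists_minimalFor x _ ⟨_, hstar v⟩
  choose hi hhi hhi' using fun v => (toFinite (L.star G v)).exists_maximalFor x _ ⟨_, hstar v⟩
  have hlo_le : ∀ v, ∀ a ∈ L.star G v, x (lo v) ≤ x a := fun v a ha =>
    (le_total (x (lo v)) (x a)).elim id (fun h => hlo' v ha h)
  have hle_hi : ∀ v, ∀ a ∈ L.star G v, x a ≤ x (hi v) := fun v a ha =>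
    (le_total (x a) (x (hi v))).elim id (fun h => hhi' v ha h)
  have hlohi : ∀ v, x (lo v) ≤ x (hi v) := fun v => hlo_le v _ (hhi v)
  -- vertices of a row are separated
  have hvv : ∀ u v, L.row u = L.row v → L.xpos u < L.xpos v → x (hi u) < x (lo v) := by
    intro u v huv hx
    refine hmono (L.row u) _ (IsLayout.active_of_mem_star (hhi u)) _
      (huv ▸ IsLayout.active_of_mem_star (hlo v)) ?_
    rw [hL.abscissa_of_mem_star (hhi u), huv, hL.abscissa_of_mem_star (hlo v)]
    exact hx
  have hve : ∀ v e, L.Meets G (L.row v) e → L.xpos v < L.cross (L.row v) e →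
      x (hi v) < x (Sum.inr e) := by
    intro v e he hx
    refine hmono (L.row v) _ (IsLayout.active_of_mem_star (hhi v)) _ he ?_
    rw [hL.abscissa_of_mem_star (hhi v)]
    exact hx
  have hev : ∀ v e, L.Meets G (L.row v) e → L.cross (L.row v) e < L.xpos v →
      x (Sum.inr e) < x (lo v) := by
    intro v e he hx
    refine hmono (L.row v) _ he _ (IsLayout.active_of_mem_star (hlo v)) ?_
    rw [hL.abscissa_of_mem_star (hlo v)]
    exact hx
  have hmem : ∀ v e, L.Meets G (L.row v) e → v ∈ e →
      x (lo v) ≤ x (Sum.inr e) ∧ x (Sum.inr e) ≤ x (hi v) := fun v e he hv =>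
    ⟨hlo_le v _ (Or.inr ⟨e, rfl, hv, he⟩), hle_hi v _ (Or.inr ⟨e, rfl, hv, he⟩)⟩
  let D : VisData V :=
    { ly := fun v => L.row v
      lx := fun v => x (lo v)
      rx := fun v => x (hi v)
      ep1 := fun e => if L.row (L.bot e) < L.row (L.top e) then
          (x (Sum.inr e), (L.row (L.bot e) : ℝ))
        else (x (hi (L.bot e)), (L.row (L.bot e) : ℝ))
      ep2 := fun e => if L.row (L.bot e) < L.row (L.top e) then
          (x (Sum.inr e), (L.row (L.top e) : ℝ))
        else (x (lo (L.top e)), (L.row (L.top e) : ℝ)) }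
  have hvseg : ∀ v p, p ∈ D.vseg v ↔ p.2 = L.row v ∧ x (lo v) ≤ p.1 ∧ p.1 ≤ x (hi v) :=
    fun v p => mem_segment_snd_eq (hlohi v)
  have hcases : ∀ e ∈ G.edgeSet,
      (L.Meets G (L.row (L.bot e)) e ∧ L.Meets G (L.row (L.top e)) e ∧
        D.ep1 e = (x (Sum.inr e), (L.row (L.bot e) : ℝ)) ∧
        D.ep2 e = (x (Sum.inr e), (L.row (L.top e) : ℝ)) ∧
        ∀ p, p ∈ D.eseg e ↔
          p.1 = x (Sum.inr e) ∧ (L.row (L.bot e) : ℝ) ≤ p.2 ∧ p.2 ≤ L.row (L.top e)) ∨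
      (L.row (L.bot e) = L.row (L.top e) ∧ L.xpos (L.bot e) < L.xpos (L.top e) ∧
        x (hi (L.bot e)) < x (lo (L.top e)) ∧
        D.ep1 e = (x (hi (L.bot e)), (L.row (L.bot e) : ℝ)) ∧
        D.ep2 e = (x (lo (L.top e)), (L.row (L.bot e) : ℝ)) ∧
        ∀ p, p ∈ D.eseg e ↔
          p.2 = L.row (L.bot e) ∧ x (hi (L.bot e)) ≤ p.1 ∧ p.1 ≤ x (lo (L.top e))) := by
    intro e he
    rcases (hL.bot_le_top e he).lt_or_eq with hlt | heq
    · left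
      have h1 : D.ep1 e = (x (Sum.inr e), (L.row (L.bot e) : ℝ)) := if_pos hlt
      have h2 : D.ep2 e = (x (Sum.inr e), (L.row (L.top e) : ℝ)) := if_pos hlt
      refine ⟨⟨he, hlt, le_rfl, hlt.le⟩, ⟨he, hlt, hlt.le, le_rfl⟩, h1, h2, fun p => ?_⟩
      rw [VisData.eseg, h1, h2]
      exact mem_segment_fst_eq (by exact_mod_cast hlt.le)
    · right
      have hx := hL.hor_lt e he heq
      have hx' := hvv _ _ heq hx
      have h1 : D.ep1 e = (x (hi (L.bot e)), (L.row (L.bot e) : ℝ)) := if_neg heq.not_lt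
      have h2 : D.ep2 e = (x (lo (L.top e)), (L.row (L.bot e) : ℝ)) := by
        rw [heq]; exact if_neg heq.not_lt
      refine ⟨heq, hx, hx', h1, h2, fun p => ?_⟩
      rw [VisData.eseg, h1, h2]
      exact mem_segment_snd_eq hx'.le
  -- a horizontal edge against a non-horizontal one
  have hhv : ∀ e ∈ G.edgeSet, ∀ f, L.row (L.bot e) = L.row (L.top e) →
      L.Meets G (L.row (L.bot e)) f → x (hi (L.bot e)) ≤ x (Sum.inr f) →
      x (Sum.inr f) ≤ x (lo (L.top e)) →
      (x (Sum.inr f) = x (hi (L.bot e)) ∨ x (Sum.inr f) = x (lo (L.top e))) ∧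
        (L.row (L.bot e) = L.row (L.bot f) ∨ L.row (L.bot e) = L.row (L.top f)) := by
    intro e he f heq hf h1 h2
    have hxx := hvv _ _ heq (hL.hor_lt e he heq)
    have hend : ∀ w, w ∈ e → w ∈ f →
        (x (Sum.inr f) = x (hi (L.bot e)) ∨ x (Sum.inr f) = x (lo (L.top e))) ∧
        (L.row (L.bot e) = L.row (L.bot f) ∨ L.row (L.bot e) = L.row (L.top f)) := by
      intro w hwe hwf
      have hw := hmem w f (hL.meets_of_mem hf.mem hf.lt hwf) hwf
      constructor
      · rcases (hL.mem_iff he).1 hwe with rfl | rfl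
        · left; linarith
        · right; linarith
      · rcases (hL.mem_iff he).1 hwe with h | h <;> rcases (hL.mem_iff hf.mem).1 hwf with h' | h'
        · left; rw [← h, ← h']
        · right; rw [← h, ← h']
        · left; rw [heq, ← h, ← h']
        · right; rw [heq, ← h, ← h']
    rcases lt_or_ge (L.cross (L.row (L.bot e)) f) (L.xpos (L.bot e)) with h3 | h3
    · have := hev _ _ hf h3
      have := hlohi (L.bot e)
      linarith
    rcases lt_or_ge (L.xpos (L.top e)) (L.cross (L.row (L.bot e)) f) with h4 | h4
    · rw [heq] at h4 hf
      have := hve _ _ hf h4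
      have := hlohi (L.top e)
      linarith
    obtain ⟨w, hwe, hwf⟩ := hL.hor_cross e he heq f hf h3 h4
    exact hend w hwe hwf
  refine ⟨D, ⟨hlohi, ?_, ?_, ?_, ?_, ?_, ?_, ?_⟩, fun _ => rfl⟩
  · exact fun v => ⟨L.row v, by exact_mod_cast hL.one_le_row v, by exact_mod_cast hL.row_le v,
      by simp [D]⟩
  · intro e he
    rcases hcases e he with ⟨-, -, h1, h2, -⟩ | ⟨-, -, -, h1, h2, -⟩ <;> rw [h1, h2]
    · exact Or.inl rfl
    · exact Or.inr rfl
  · intro e he p hp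
    have b1 : (1 : ℝ) ≤ L.row (L.bot e) := by exact_mod_cast hL.one_le_row _
    have b2 : (L.row (L.bot e) : ℝ) ≤ h := by exact_mod_cast hL.row_le _
    have b3 : (L.row (L.top e) : ℝ) ≤ h := by exact_mod_cast hL.row_le _
    rcases hcases e he with ⟨-, -, -, -, h3⟩ | ⟨-, -, -, -, -, h3⟩
    · have := (h3 p).1 hp
      constructor <;> linarith
    · have := (h3 p).1 hp
      constructor <;> linarith
  · intro u v huv
    have key : D.ep1 s(u, v) ∈ D.vseg (L.bot s(u, v)) ∧ D.ep2 s(u, v) ∈ D.vseg (L.top s(u, v)) := by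
      rcases hcases s(u, v) huv with ⟨h1, h2, h3, h4, -⟩ | ⟨h0, h1, h2, h3, h4, -⟩
      · rw [hvseg, hvseg, h3, h4]
        exact ⟨⟨rfl, hmem _ _ h1 ((hL.mem_iff huv).2 (Or.inl rfl))⟩,
          ⟨rfl, hmem _ _ h2 ((hL.mem_iff huv).2 (Or.inr rfl))⟩⟩
      · rw [hvseg, hvseg, h3, h4]
        exact ⟨⟨rfl, hlohi _, le_rfl⟩, ⟨by rw [h0], le_rfl, hlohi _⟩⟩
    rcases Sym2.eq_iff.1 (hL.eq_mk s(u, v) huv) with ⟨h1, h2⟩ | ⟨h1, h2⟩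
    · left; rwa [← h1, ← h2] at key
    · right; rwa [← h1, ← h2] at key
  · intro u v huv
    rw [Set.disjoint_left]
    intro p hp hp'
    obtain ⟨a1, a2, a3⟩ := (hvseg _ _).1 hp
    obtain ⟨b1, b2, b3⟩ := (hvseg _ _).1 hp'
    have hr : L.row u = L.row v := by exact_mod_cast a1.symm.trans b1
    rcases lt_trichotomy (L.xpos u) (L.xpos v) with hx | hx | hx
    · have := hvv _ _ hr hx; linarith
    · exact huv (hL.xpos_inj _ _ hr hx)
    · have := hvv _ _ hr.symm hx; linarith
  · rintro e he w p ⟨hp, hp'⟩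
    obtain ⟨a1, a2, a3⟩ := (hvseg _ _).1 hp'
    rcases hcases e he with ⟨h1, h2, h3, h4, h5⟩ | ⟨h0, h1, h2, h3, h4, h5⟩
    · obtain ⟨b1, b2, b3⟩ := (h5 p).1 hp
      rw [a1] at b2 b3
      have hw : L.Meets G (L.row w) e := ⟨he, h1.lt, by exact_mod_cast b2, by exact_mod_cast b3⟩
      have hwe : w ∈ e := by
        refine hL.cross_eq_xpos e _ w hw rfl ?_
        by_contra hne
        rcases lt_or_gt_of_ne hne with hlt | hlt
        · have := hev _ _ hw hlt; linarith
        · have := hve _ _ hw hlt; linarith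
      rw [h3, h4]
      rcases (hL.mem_iff he).1 hwe with rfl | rfl
      · exact Or.inl (Prod.ext b1 a1)
      · exact Or.inr (Prod.ext b1 a1)
    · obtain ⟨b1, b2, b3⟩ := (h5 p).1 hp
      have hr : L.row w = L.row (L.bot e) := by exact_mod_cast a1.symm.trans b1
      rcases lt_or_ge (L.xpos w) (L.xpos (L.bot e)) with hx | hx
      · have := hvv _ _ hr hx
        have := hlohi (L.bot e)
        linarith
      rcases lt_or_ge (L.xpos (L.top e)) (L.xpos w) with hx' | hx'
      · have := hvv _ _ (h0.symm.trans hr.symm) hx'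
        have := hlohi (L.top e)
        linarith
      rw [h3, h4]
      rcases (hL.mem_iff he).1 (hL.hor_vert e he h0 w hr hx hx') with rfl | rfl
      · exact Or.inl (Prod.ext (le_antisymm a3 b2) b1)
      · exact Or.inr (Prod.ext (le_antisymm b3 a2) b1)
  · rintro e he f hf hef p ⟨hp, hp'⟩
    rcases hcases e he with ⟨h1, h2, h3, h4, h5⟩ | ⟨h0, h1, h2, h3, h4, h5⟩ <;>
    rcases hcases f hf with ⟨k1, k2, k3, k4, k5⟩ | ⟨k0, k1, k2, k3, k4, k5⟩
    · exfalso
      obtain ⟨a1, a2, a3⟩ := (h5 p).1 hp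
      obtain ⟨b1, b2, b3⟩ := (k5 p).1 hp'
      have c1 : L.row (L.bot e) ≤ L.row (L.top f) := by exact_mod_cast a2.trans b3
      have c2 : L.row (L.bot f) ≤ L.row (L.top e) := by exact_mod_cast b2.trans a3
      rcases le_total (L.row (L.bot e)) (L.row (L.bot f)) with hle | hle
      · exact hne (L.row (L.bot f)) e f ⟨he, h1.lt, hle, c2⟩ k1 hef (a1.symm.trans b1)
      · exact hne (L.row (L.bot e)) e f h1 ⟨hf, k1.lt, hle, c1⟩ hef (a1.symm.trans b1)
    · obtain ⟨a1, a2, a3⟩ := (h5 p).1 hp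
      obtain ⟨b1, b2, b3⟩ := (k5 p).1 hp'
      rw [b1] at a2 a3
      rw [a1] at b2 b3
      obtain ⟨c1, c2⟩ := hhv f hf e k0
        ⟨he, h1.lt, by exact_mod_cast a2, by exact_mod_cast a3⟩ b2 b3
      rw [h3, h4, k3, k4]
      constructor
      · exact c2.imp (fun c => Prod.ext a1 (by rw [b1, c])) (fun c => Prod.ext a1 (by rw [b1, c]))
      · exact c1.imp (fun c => Prod.ext (a1.trans c) b1) (fun c => Prod.ext (a1.trans c) b1)
    · obtain ⟨a1, a2, a3⟩ := (k5 p).1 hp'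
      obtain ⟨b1, b2, b3⟩ := (h5 p).1 hp
      rw [b1] at a2 a3
      rw [a1] at b2 b3
      obtain ⟨c1, c2⟩ := hhv e he f h0
        ⟨hf, k1.lt, by exact_mod_cast a2, by exact_mod_cast a3⟩ b2 b3
      rw [h3, h4, k3, k4]
      constructor
      · exact c1.imp (fun c => Prod.ext (a1.trans c) b1) (fun c => Prod.ext (a1.trans c) b1)
      · exact c2.imp (fun c => Prod.ext a1 (by rw [b1, c])) (fun c => Prod.ext a1 (by rw [b1, c]))
    · obtain ⟨a1, a2, a3⟩ := (h5 p).1 hp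
      obtain ⟨b1, b2, b3⟩ := (k5 p).1 hp'
      have hr : L.row (L.bot e) = L.row (L.bot f) := by exact_mod_cast a1.symm.trans b1
      -- compare the ends of `e` and `f`
      have hsep : ∀ u v, L.row u = L.row v → x (lo v) ≤ x (hi u) → L.xpos v ≤ L.xpos u :=
        fun u v huv hx => not_lt.1 fun hlt => (hvv u v huv hlt).not_ge hx
      have hbe := hlohi (L.bot e)
      have hbf := hlohi (L.bot f)
      have hte := hlohi (L.top e)
      have htf := hlohi (L.top f)
      have d1 : L.xpos (L.bot e) ≤ L.xpos (L.top f) := hsep _ _ (by omega) (by linarith)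
      have d2 : L.xpos (L.bot f) ≤ L.xpos (L.top e) := hsep _ _ (by omega) (by linarith)
      obtain ⟨hor, -⟩ := hL.hor_hor he hf hef h0 k0 hr
        (x := max (L.xpos (L.bot e)) (L.xpos (L.bot f)))
        (le_max_left _ _) (max_le h1.le d2) (le_max_right _ _) (max_le d1 k1.le)
      rw [h3, h4, k3, k4]
      rcases hor with s | s
      · rw [s] at b2 k2
        have e1 : p.1 = x (lo (L.top e)) := by linarith
        have e2 : p.1 = x (hi (L.bot f)) := by rw [s]; linarith
        exact ⟨Or.inr (Prod.ext e1 a1), Or.inl (Prod.ext e2 b1)⟩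
      · rw [s] at a2 h2
        have e1 : p.1 = x (hi (L.bot e)) := by rw [s]; linarith
        have e2 : p.1 = x (lo (L.top f)) := by linarith
        exact ⟨Or.inl (Prod.ext e1 a1), Or.inr (Prod.ext e2 b1)⟩

/-- A point of a segment between two horizontal lines is determined by its height. -/
theorem fst_of_mem_segment {a b y y' : ℝ} {z : Pt} (hz : z ∈ segment ℝ ((a, y) : Pt) (b, y')) :
    ∃ θ ∈ Icc (0 : ℝ) 1, z.1 = a + θ * (b - a) ∧ z.2 = y + θ * (y' - y) := by
  rw [segment_eq_image'] at hz
  obtain ⟨θ, hθ, rfl⟩ := hz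
  exact ⟨θ, hθ, by simp, by simp⟩

theorem mk_mem_segment {a b y y' θ : ℝ} (hθ : θ ∈ Icc (0 : ℝ) 1) :
    ((a + θ * (b - a), y + θ * (y' - y)) : Pt) ∈ segment ℝ ((a, y) : Pt) (b, y') := by
  rw [segment_eq_image']
  exact ⟨θ, hθ, by ext <;> simp⟩

/-- The chain of `n` segments joining the points `(p i, i)` for `k ≤ i ≤ k + n`. -/
def rowChain (p : ℕ → ℝ) : ℕ → ℕ → List Pt
  | 0, k => [(p k, (k : ℝ))]
  | n + 1, k => (p k, (k : ℝ)) :: rowChain p n (k + 1)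

section rowChain

variable (p : ℕ → ℝ)

theorem rowChain_eq_cons (n k : ℕ) : ∃ l, rowChain p n k = (p k, (k : ℝ)) :: l := by
  cases n <;> exact ⟨_, rfl⟩

theorem chainSet_rowChain_succ (n k : ℕ) : chainSet (rowChain p (n + 1) k) =
    segment ℝ (p k, (k : ℝ)) (p (k + 1), ((k + 1 : ℕ) : ℝ)) ∪ chainSet (rowChain p n (k + 1)) := by
  obtain ⟨l, hl⟩ := rowChain_eq_cons p n (k + 1)
  rw [rowChain, hl, chainSet]

theorem head?_rowChain (n k : ℕ) : (rowChain p n k).head? = some (p k, (k : ℝ)) := by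
  obtain ⟨l, hl⟩ := rowChain_eq_cons p n k
  rw [hl, List.head?_cons]

theorem getLast?_rowChain (n k : ℕ) :
    (rowChain p n k).getLast? = some (p (k + n), ((k + n : ℕ) : ℝ)) := by
  induction n generalizing k with
  | zero => rfl
  | succ n ih =>
    obtain ⟨l, hl⟩ := rowChain_eq_cons p n (k + 1)
    rw [rowChain, hl, List.getLast?_cons_cons, ← hl, ih, show k + 1 + n = k + (n + 1) by ring]

theorem exists_of_mem_rowChain {n k : ℕ} {z : Pt} (hz : z ∈ rowChain p n k) :
    ∃ i, k ≤ i ∧ i ≤ k + n ∧ z = (p i, (i : ℝ)) := by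
  induction n generalizing k with
  | zero => exact ⟨k, le_rfl, le_rfl, by simpa [rowChain] using hz⟩
  | succ n ih =>
    rcases List.mem_cons.1 hz with rfl | hz
    · exact ⟨k, le_rfl, by omega, rfl⟩
    · obtain ⟨i, h1, h2, h3⟩ := ih hz
      exact ⟨i, by omega, by omega, h3⟩

theorem isChain_rowChain (n k : ℕ) :
    List.IsChain (· ≤ ·) ((rowChain p n k).map Prod.snd) := by
  induction n generalizing k with
  | zero => simp [rowChain]
  | succ n ih =>
    have := ih (k + 1)
    obtain ⟨l, hl⟩ := rowChain_eq_cons p n (k + 1)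
    rw [hl, List.map_cons] at this
    rw [rowChain, hl, List.map_cons, List.map_cons]
    exact List.IsChain.cons_cons (by simp) this

theorem exists_of_mem_chainSet_rowChain {n k : ℕ} (hn : 0 < n) {z : Pt}
    (hz : z ∈ chainSet (rowChain p n k)) :
    ∃ i, k ≤ i ∧ i < k + n ∧ ∃ θ ∈ Icc (0 : ℝ) 1,
      z.1 = p i + θ * (p (i + 1) - p i) ∧ z.2 = i + θ := by
  induction n generalizing k with
  | zero => omega
  | succ n ih =>
    rw [chainSet_rowChain_succ] at hz
    have first : z ∈ segment ℝ (p k, (k : ℝ)) (p (k + 1), ((k + 1 : ℕ) : ℝ)) →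
        ∃ i, k ≤ i ∧ i < k + (n + 1) ∧ ∃ θ ∈ Icc (0 : ℝ) 1,
          z.1 = p i + θ * (p (i + 1) - p i) ∧ z.2 = i + θ := by
      intro hz
      obtain ⟨θ, hθ, h1, h2⟩ := fst_of_mem_segment hz
      exact ⟨k, le_rfl, by omega, θ, hθ, h1, by rw [h2]; push_cast; ring⟩
    rcases hz with hz | hz
    · exact first hz
    · rcases Nat.eq_zero_or_pos n with rfl | hn
      · refine first ?_
        have : z = (p (k + 1), ((k + 1 : ℕ) : ℝ)) := hz
        rw [this]
        exact right_mem_segment _ _ _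
      · obtain ⟨i, h1, h2, h3⟩ := ih hn hz
        exact ⟨i, by omega, by omega, h3⟩

theorem exists_continuous_chainSet_rowChain (n k : ℕ) :
    ∃ F : ℝ → ℝ, Continuous F ∧ F k = p k ∧ F (k + n) = p (k + n) ∧
      chainSet (rowChain p n k) = (fun y => ((F y, y) : Pt)) '' Icc (k : ℝ) (k + n) := by
  induction n generalizing k with
  | zero => exact ⟨fun _ => p k, continuous_const, rfl, rfl, by simp [rowChain, chainSet]⟩
  | succ n ih =>
    obtain ⟨F, hF, hFk, hFn, hFs⟩ := ih (k + 1)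
    push_cast at hFk hFn hFs
    refine ⟨fun y => if y ≤ k + 1 then p k + (y - k) * (p (k + 1) - p k) else F y, ?_, ?_, ?_, ?_⟩
    · refine Continuous.if_le (by fun_prop) hF continuous_id continuous_const ?_
      rintro y rfl
      rw [hFk]; ring
    · simp
    · have hk : ((k : ℝ) + ((n + 1 : ℕ) : ℝ)) = k + 1 + n := by push_cast; ring
      simp only [hk]
      split_ifs with h
      · have : n = 0 := by
          have : (n : ℝ) ≤ 0 := by linarith
          exact_mod_cast this.antisymm (by positivity)
        subst this
        simp
      · rw [hFn, show k + 1 + n = k + (n + 1) by ring]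
    · rw [chainSet_rowChain_succ, hFs]
      have hn : (0 : ℝ) ≤ n := by positivity
      push_cast
      ext z
      constructor
      · rintro (hz | ⟨y, hy, rfl⟩)
        · obtain ⟨θ, ⟨h3, h4⟩, h1, h2⟩ := fst_of_mem_segment hz
          refine ⟨z.2, ⟨by linarith, by linarith⟩, Prod.ext ?_ rfl⟩
          simp only
          rw [if_pos (by linarith), h1, h2]
          ring
        · refine ⟨y, ⟨by linarith [hy.1], by linarith [hy.2]⟩, Prod.ext ?_ rfl⟩
          simp only
          split_ifs with h
          · obtain rfl : y = k + 1 := le_antisymm h hy.1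
            rw [hFk]; ring
          · rfl
      · rintro ⟨y, ⟨hy, hy'⟩, rfl⟩
        rcases le_or_gt y (k + 1) with h | h
        · left
          have := mk_mem_segment (a := p k) (b := p (k + 1)) (y := k) (y' := k + 1)
            (θ := y - k) ⟨by linarith, by linarith⟩
          simp only [if_pos h]
          convert this using 2
          ring
        · right
          exact ⟨y, ⟨by linarith, by linarith⟩, by simp only [if_neg h.not_ge]⟩

end rowChain

theorem IsSimpleArc.symm {S : Set Pt} {a b : Pt} (hS : IsSimpleArc S a b) : IsSimpleArc S b a := by
  obtain ⟨γ, h1, h2, h3, h4, h5⟩ := hS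
  have hmaps : MapsTo (fun t : ℝ => 1 - t) (Icc 0 1) (Icc 0 1) := fun t ht =>
    ⟨by linarith [ht.2], by linarith [ht.1]⟩
  refine ⟨fun t => γ (1 - t), h1.comp (by fun_prop) hmaps, ?_, ?_, by simpa, by simpa⟩
  · exact h2.comp (fun s _ t _ hst => by simpa using hst) hmaps
  · rw [← h3]
    ext z
    constructor
    · rintro ⟨t, ht, rfl⟩
      exact ⟨1 - t, hmaps ht, rfl⟩
    · rintro ⟨t, ht, rfl⟩
      exact ⟨1 - t, hmaps ht, by simp⟩

theorem IsSimpleArc.left_mem {S : Set Pt} {a b : Pt} (hS : IsSimpleArc S a b) : a ∈ S := by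
  obtain ⟨γ, -, -, h3, rfl, -⟩ := hS
  exact h3 ▸ mem_image_of_mem _ (by simp)

theorem isSimpleArc_segment {a b : Pt} (hab : a ≠ b) : IsSimpleArc (segment ℝ a b) a b :=
  ⟨AffineMap.lineMap a b, (AffineMap.lineMap_continuous).continuousOn,
    (AffineMap.lineMap_injective ℝ hab).injOn, (segment_eq_image_lineMap ℝ a b).symm,
    AffineMap.lineMap_apply_zero a b, AffineMap.lineMap_apply_one a b⟩

theorem isSimpleArc_rowChain (p : ℕ → ℝ) {n k : ℕ} (hn : 0 < n) :
    IsSimpleArc (chainSet (rowChain p n k)) (p k, (k : ℝ)) (p (k + n), ((k + n : ℕ) : ℝ)) := by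
  obtain ⟨F, hF, hFk, hFn, hFs⟩ := exists_continuous_chainSet_rowChain p n k
  have hn' : (0 : ℝ) < n := by exact_mod_cast hn
  refine ⟨fun t => (F (k + n * t), k + n * t), by fun_prop, ?_, ?_, ?_, ?_⟩
  · intro s _ t _ hst
    have := congrArg Prod.snd hst
    simp only [add_right_inj, mul_eq_mul_left_iff] at this
    exact this.resolve_right hn'.ne'
  · rw [hFs]
    ext z
    constructor
    · rintro ⟨t, ht, rfl⟩
      refine ⟨k + n * t, ⟨?_, ?_⟩, rfl⟩ <;> nlinarith [ht.1, ht.2]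
    · rintro ⟨y, hy, rfl⟩
      refine ⟨(y - k) / n, ⟨?_, ?_⟩, ?_⟩
      · exact div_nonneg (by linarith [hy.1]) hn'.le
      · rw [div_le_one hn']; linarith [hy.2]
      · have : (k : ℝ) + n * ((y - k) / n) = y := by field_simp; ring
        simp only [this]
  · simp [hFk]
  · simp [hFn]

theorem mem_of_mem_chainBends {l : List Pt} {p : Pt} (hp : p ∈ chainBends l) : p ∈ l :=
  List.drop_subset _ _ (List.dropLast_subset _ hp)

open Classical in
/-- Every layout is realised by a planar `y`-monotone drawing. -/
theorem RowData.IsLayout.exists_polyDrawing {V : Type} {L : RowData V}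
    {G : SimpleGraph V} {h : ℕ} (hL : L.IsLayout G h) :
    ∃ Γ : PolyDrawing G, Γ.IsPlanar ∧ Γ.IsYMonotone ∧ Γ.HasHeight h ∧
      ∀ v, (Γ.pos v).2 = L.row v := by
  let pos : V → Pt := fun v => (L.xpos v, (L.row v : ℝ))
  let arc : Sym2 V → List Pt := fun e =>
    if L.row (L.bot e) < L.row (L.top e) then
      rowChain (fun k => L.cross k e) (L.row (L.top e) - L.row (L.bot e)) (L.row (L.bot e))
    else [pos (L.bot e), pos (L.top e)]
  have hpos : Function.Injective pos := fun u v huv =>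
    hL.xpos_inj u v (Nat.cast_injective (R := ℝ) (congrArg Prod.snd huv)) (congrArg Prod.fst huv)
  have harc : ∀ e ∈ G.edgeSet, (arc e).head? = some (pos (L.bot e)) ∧
      (arc e).getLast? = some (pos (L.top e)) ∧
      IsSimpleArc (chainSet (arc e)) (pos (L.bot e)) (pos (L.top e)) := by
    intro e he
    simp only [arc]
    split_ifs with hlt
    · have hb := hL.cross_bot e _ ⟨he, hlt, le_rfl, hlt.le⟩ rfl
      have ht := hL.cross_top e _ ⟨he, hlt, hlt.le, le_rfl⟩ rfl
      have hsum : L.row (L.bot e) + (L.row (L.top e) - L.row (L.bot e)) = L.row (L.top e) := by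
        omega
      have h3 := isSimpleArc_rowChain (fun k => L.cross k e) (k := L.row (L.bot e))
        (n := L.row (L.top e) - L.row (L.bot e)) (by omega)
      rw [head?_rowChain, getLast?_rowChain]
      simp only [hsum, hb, ht] at h3 ⊢
      exact ⟨rfl, rfl, h3⟩
    · refine ⟨rfl, rfl, ?_⟩
      have hs : chainSet [pos (L.bot e), pos (L.top e)] =
          segment ℝ (pos (L.bot e)) (pos (L.top e)) := by
        simp [chainSet, right_mem_segment]
      rw [hs]
      exact isSimpleArc_segment (hpos.ne (hL.bot_ne_top he))
  let Γ : PolyDrawing G :=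
    { pos := pos
      pos_inj := hpos
      arc := arc
      arc_ends := fun u v huv => by
        obtain ⟨h1, h2, -⟩ := harc s(u, v) huv
        rcases Sym2.eq_iff.1 (hL.eq_mk s(u, v) huv) with ⟨h3, h4⟩ | ⟨h3, h4⟩
        · left; rw [h1, h2, ← h3, ← h4]; exact ⟨rfl, rfl⟩
        · right; rw [h1, h2, ← h3, ← h4]; exact ⟨rfl, rfl⟩
      arc_simple := fun u v huv => by
        obtain ⟨-, -, h1⟩ := harc s(u, v) huv
        rcases Sym2.eq_iff.1 (hL.eq_mk s(u, v) huv) with ⟨h3, h4⟩ | ⟨h3, h4⟩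
        · rwa [← h3, ← h4] at h1
        · rw [← h3, ← h4] at h1; exact h1.symm }
  have hrise : ∀ e ∈ G.edgeSet, L.row (L.bot e) < L.row (L.top e) → ∀ z ∈ Γ.edgePts e,
      ∃ i, L.Meets G i e ∧ L.Meets G (i + 1) e ∧ ∃ θ ∈ Icc (0 : ℝ) 1,
        z.1 = L.cross i e + θ * (L.cross (i + 1) e - L.cross i e) ∧ z.2 = i + θ := by
    intro e he hlt z hz
    have : Γ.edgePts e = chainSet (rowChain (fun k => L.cross k e)
        (L.row (L.top e) - L.row (L.bot e)) (L.row (L.bot e))) := by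
      simp only [PolyDrawing.edgePts, Γ, arc, if_pos hlt]
    rw [this] at hz
    obtain ⟨i, h1, h2, h3⟩ := exists_of_mem_chainSet_rowChain _ (by omega) hz
    exact ⟨i, ⟨he, hlt, h1, by omega⟩, ⟨he, hlt, by omega, by omega⟩, h3⟩
  -- a point of a rising edge at integer height is the recorded crossing
  have hrow : ∀ e ∈ G.edgeSet, L.row (L.bot e) < L.row (L.top e) → ∀ z ∈ Γ.edgePts e, ∀ k : ℕ,
      z.2 = k → L.Meets G k e ∧ z.1 = L.cross k e := by
    intro e he hlt z hz k hk
    obtain ⟨i, h1, h2, θ, hθ, h3, h4⟩ := hrise e he hlt z hz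
    have h5 := hθ.1
    have h6 := hθ.2
    have h7 : (i : ℝ) ≤ k := by linarith
    have h8 : (k : ℝ) ≤ (i + 1 : ℕ) := by push_cast; linarith
    have h7' : i ≤ k := by exact_mod_cast h7
    have h8' : k ≤ i + 1 := by exact_mod_cast h8
    rcases h7'.eq_or_lt with rfl | h9
    · obtain rfl : θ = 0 := by linarith
      exact ⟨h1, by rw [h3]; ring⟩
    · obtain rfl : k = i + 1 := by omega
      obtain rfl : θ = 1 := by push_cast at hk; linarith
      exact ⟨h2, by rw [h3]; ring⟩
  have hhor : ∀ e ∈ G.edgeSet, L.row (L.bot e) = L.row (L.top e) → ∀ z ∈ Γ.edgePts e,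
      z.2 = L.row (L.bot e) ∧ L.xpos (L.bot e) ≤ z.1 ∧ z.1 ≤ L.xpos (L.top e) := by
    intro e he heq z hz
    have : Γ.edgePts e = segment ℝ (pos (L.bot e)) (pos (L.top e)) := by
      simp [PolyDrawing.edgePts, Γ, arc, heq, chainSet, right_mem_segment]
    rw [this] at hz
    simp only [pos, ← heq] at hz
    exact (mem_segment_snd_eq (hL.hor_lt e he heq).le).1 hz
  have hrowmem : ∀ e ∈ G.edgeSet, L.row (L.bot e) = L.row (L.top e) → ∀ w ∈ e,
      L.row w = L.row (L.bot e) := by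
    intro e he heq w hw
    rcases (hL.mem_iff he).1 hw with rfl | rfl
    · rfl
    · exact heq.symm
  have hrr : ∀ e ∈ G.edgeSet, ∀ f ∈ G.edgeSet, e ≠ f → L.row (L.bot e) < L.row (L.top e) →
      L.row (L.bot f) < L.row (L.top f) → ∀ z ∈ Γ.edgePts e ∩ Γ.edgePts f,
      ∃ w : V, w ∈ e ∧ w ∈ f ∧ z = Γ.pos w := by
    rintro e he f hf hef hlt hlt' z ⟨hz, hz'⟩
    have hcommon : ∀ k : ℕ, z.2 = k → ∃ w : V, w ∈ e ∧ w ∈ f ∧ z = Γ.pos w := by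
      intro k hk
      obtain ⟨h1, h2⟩ := hrow e he hlt z hz k hk
      obtain ⟨h3, h4⟩ := hrow f hf hlt' z hz' k hk
      obtain ⟨w, hwe, hwf, hw⟩ := hL.cross_eq e f k h1 h3 hef (h2.symm.trans h4)
      refine ⟨w, hwe, hwf, Prod.ext ?_ ?_⟩
      · rw [h2]; exact hL.cross_of_mem h1 hwe hw
      · rw [hk, ← hw]
    obtain ⟨i, h1, h2, θ, ⟨h3, h4⟩, h5, h6⟩ := hrise e he hlt z hz
    obtain ⟨j, k1, k2, φ, ⟨k3, k4⟩, k5, k6⟩ := hrise f hf hlt' z hz'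
    rcases h3.eq_or_lt with rfl | h3
    · exact hcommon i (by rw [h6]; ring)
    rcases h4.eq_or_lt with rfl | h4
    · exact hcommon (i + 1) (by rw [h6]; push_cast; ring)
    have hij : i = j := by
      have b1 : (i : ℝ) < (j + 1 : ℕ) := by push_cast; linarith
      have b2 : (j : ℝ) < (i + 1 : ℕ) := by push_cast; linarith
      have b1' : i < j + 1 := by exact_mod_cast b1
      have b2' : j < i + 1 := by exact_mod_cast b2
      omega
    subst hij
    obtain rfl : φ = θ := by linarith
    exfalso
    have hcc : L.cross i e = L.cross i f ∧ L.cross (i + 1) e = L.cross (i + 1) f := by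
      rcases lt_or_gt_of_ne (hL.mid_ne e f i h1 k1 h2 k2 hef) with hm | hm
      · obtain ⟨c1, c2⟩ := hL.mid_lt e f i h1 k1 h2 k2 hm
        constructor <;> refine le_antisymm ‹_› ?_ <;> nlinarith
      · obtain ⟨c1, c2⟩ := hL.mid_lt f e i k1 h1 k2 h2 hm
        constructor <;> refine le_antisymm ?_ ‹_› <;> nlinarith
    obtain ⟨w, hwe, hwf, hw⟩ := hL.cross_eq e f i h1 k1 hef hcc.1
    obtain ⟨w', hwe', hwf', hw'⟩ := hL.cross_eq e f (i + 1) h2 k2 hef hcc.2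
    have hne : w ≠ w' := by rintro rfl; omega
    rw [(Sym2.mem_and_mem_iff hne).1 ⟨hwe, hwe'⟩, (Sym2.mem_and_mem_iff hne).1 ⟨hwf, hwf'⟩] at hef
    exact hef rfl
  have hrh : ∀ e ∈ G.edgeSet, ∀ f ∈ G.edgeSet, L.row (L.bot e) = L.row (L.top e) →
      L.row (L.bot f) < L.row (L.top f) → ∀ z ∈ Γ.edgePts e ∩ Γ.edgePts f,
      ∃ w : V, w ∈ e ∧ w ∈ f ∧ z = Γ.pos w := by
    rintro e he f hf heq hlt z ⟨hz, hz'⟩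
    obtain ⟨h1, h2, h3⟩ := hhor e he heq z hz
    obtain ⟨h4, h5⟩ := hrow f hf hlt z hz' _ h1
    rw [h5] at h2 h3
    obtain ⟨w, hwe, hwf⟩ := hL.hor_cross e he heq f h4 h2 h3
    have hw := hrowmem e he heq w hwe
    refine ⟨w, hwe, hwf, Prod.ext ?_ ?_⟩
    · rw [h5]; exact hL.cross_of_mem h4 hwf hw
    · rw [h1, ← hw]
  refine ⟨Γ, ⟨?_, ?_⟩, ?_, ⟨?_, ?_⟩, fun v => rfl⟩
  · intro v e he hve hv
    rcases (hL.bot_le_top e he).lt_or_eq with hlt | heq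
    · obtain ⟨h1, h2⟩ := hrow e he hlt _ hv (L.row v) rfl
      exact hve (hL.cross_eq_xpos e _ v h1 rfl h2.symm)
    · obtain ⟨h1, h2, h3⟩ := hhor e he heq _ hv
      exact hve (hL.hor_vert e he heq v (Nat.cast_injective (R := ℝ) h1) h2 h3)
  · intro e he f hf hef z hz
    rcases (hL.bot_le_top e he).lt_or_eq with hlt | heq <;>
    rcases (hL.bot_le_top f hf).lt_or_eq with hlt' | heq'
    · exact hrr e he f hf hef hlt hlt' z hz
    · obtain ⟨w, h1, h2, h3⟩ := hrh f hf e he heq' hlt z hz.symm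
      exact ⟨w, h2, h1, h3⟩
    · exact hrh e he f hf heq hlt' z hz
    · obtain ⟨h1, h2, h3⟩ := hhor e he heq z hz.1
      obtain ⟨k1, k2, k3⟩ := hhor f hf heq' z hz.2
      obtain ⟨-, w, hwe, hwf, hw⟩ := hL.hor_hor he hf hef heq heq'
        (by exact_mod_cast h1.symm.trans k1) h2 h3 k2 k3
      exact ⟨w, hwe, hwf, Prod.ext hw (by rw [h1, ← hrowmem e he heq w hwe])⟩
  · intro e he
    left
    simp only [Γ, arc]
    split_ifs with hlt
    · exact isChain_rowChain _ _ _
    · have heq : L.row (L.bot e) = L.row (L.top e) := by have := hL.bot_le_top e he; omega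
      simp only [pos, heq, List.map_cons, List.map_nil]
      exact List.IsChain.cons_cons le_rfl (List.IsChain.singleton _)
  · exact fun v => ⟨L.row v, by exact_mod_cast hL.one_le_row v, by exact_mod_cast hL.row_le v,
      by simp [Γ, pos]⟩
  · intro e he z hz
    have b1 := hL.one_le_row (L.bot e)
    have b2 := hL.row_le (L.top e)
    simp only [Γ, arc] at hz
    split_ifs at hz with hlt
    · obtain ⟨i, h1, h2, rfl⟩ := exists_of_mem_rowChain _ (mem_of_mem_chainBends hz)
      exact ⟨i, by omega, by omega, by simp⟩
    · simp [chainBends] at hz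

/-- Every pair can be listed in lexicographic order of row and abscissa. -/
theorem exists_oriented_rep {V : Type} (row : V → ℕ) (x : V → ℝ) (e : Sym2 V) :
    ∃ b t, e = s(b, t) ∧ (row b < row t ∨ row b = row t ∧ x b ≤ x t) := by
  induction e with
  | h u v =>
    rcases lt_trichotomy (row u) (row v) with h | h | h
    · exact ⟨u, v, rfl, Or.inl h⟩
    · rcases le_total (x u) (x v) with h' | h'
      · exact ⟨u, v, rfl, Or.inr ⟨h, h'⟩⟩
      · exact ⟨v, u, Sym2.eq_swap, Or.inr ⟨h.symm, h'⟩⟩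
    · exact ⟨v, u, Sym2.eq_swap, Or.inl h⟩

theorem exists_nat_row {h : ℕ} {y : ℝ} (hy : ∃ k : ℤ, 1 ≤ k ∧ k ≤ (h : ℤ) ∧ y = (k : ℝ)) :
    ∃ n : ℕ, 1 ≤ n ∧ n ≤ h ∧ y = n := by
  obtain ⟨k, h1, h2, rfl⟩ := hy
  lift k to ℕ using by omega
  exact ⟨k, by omega, by omega, by simp⟩

open Classical in
/-- Every flat visibility representation yields a layout. -/
theorem IsFlatVisRep.exists_layout {V : Type} {G : SimpleGraph V} {D : VisData V} {h : ℕ}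
    (hD : IsFlatVisRep G D h) :
    ∃ L : RowData V, L.IsLayout G h ∧ ∀ v, (L.row v : ℝ) = D.ly v := by
  obtain ⟨hlr, hly, hor, -, hends, hdisj, hev, hee⟩ := hD
  choose row hrow1 hrowh hrow using fun v => exists_nat_row (hly v)
  choose bot top hbt hord using exists_oriented_rep row D.lx
  have hvseg : ∀ v p, p ∈ D.vseg v ↔ p.2 = row v ∧ D.lx v ≤ p.1 ∧ p.1 ≤ D.rx v := by
    intro v p
    rw [VisData.vseg, hrow]
    exact mem_segment_snd_eq (hlr v)
  have huniq : ∀ u v a, row u = row v → D.lx u ≤ a → a ≤ D.rx u → D.lx v ≤ a → a ≤ D.rx v →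
      u = v := by
    intro u v a huv h1 h2 h3 h4
    by_contra hne
    exact Set.disjoint_left.1 (hdisj u v hne) ((hvseg u (a, (row u : ℝ))).2 ⟨rfl, h1, h2⟩)
      ((hvseg v (a, (row u : ℝ))).2 ⟨by rw [huv], h3, h4⟩)
  have hmem : ∀ e w, w ∈ e ↔ w = bot e ∨ w = top e := by
    intro e w
    conv_lhs => rw [hbt e]
    exact Sym2.mem_iff
  have hE : ∀ e ∈ G.edgeSet, ∃ p q, p ∈ D.vseg (bot e) ∧ q ∈ D.vseg (top e) ∧
      D.eseg e = segment ℝ p q ∧ (p.1 = q.1 ∨ p.2 = q.2) ∧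
      ∀ z, (z = D.ep1 e ∨ z = D.ep2 e) → z = p ∨ z = q := by
    intro e he
    have hadj : G.Adj (bot e) (top e) := by rwa [hbt e] at he
    have := hends _ _ hadj
    rw [← hbt e] at this
    rcases this with ⟨h1, h2⟩ | ⟨h1, h2⟩
    · exact ⟨D.ep1 e, D.ep2 e, h1, h2, rfl, hor e he, fun z hz => hz⟩
    · exact ⟨D.ep2 e, D.ep1 e, h2, h1, segment_symm _ _ _,
        (hor e he).imp Eq.symm Eq.symm, fun z hz => hz.symm⟩
  have hvert : ∀ e, ∃ x : ℝ, e ∈ G.edgeSet → row (bot e) < row (top e) →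
      (D.lx (bot e) ≤ x ∧ x ≤ D.rx (bot e)) ∧ (D.lx (top e) ≤ x ∧ x ≤ D.rx (top e)) ∧
      (∀ y : ℝ, row (bot e) ≤ y → y ≤ row (top e) → (x, y) ∈ D.eseg e) ∧
      ∀ z, (z = D.ep1 e ∨ z = D.ep2 e) →
        z = (x, (row (bot e) : ℝ)) ∨ z = (x, (row (top e) : ℝ)) := by
    intro e
    by_cases he : e ∈ G.edgeSet ∧ row (bot e) < row (top e)
    swap
    · exact ⟨0, fun h1 h2 => absurd ⟨h1, h2⟩ he⟩
    obtain ⟨he, hlt⟩ := he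
    obtain ⟨⟨p1, p2⟩, ⟨q1, q2⟩, hp, hq, hs, hpq, hz⟩ := hE e he
    obtain ⟨rfl, hp1⟩ := (hvseg _ _).1 hp
    obtain ⟨rfl, hq1⟩ := (hvseg _ _).1 hq
    obtain rfl : p1 = q1 := hpq.resolve_right fun h => hlt.ne (Nat.cast_injective (R := ℝ) h)
    refine ⟨p1, fun _ _ => ⟨hp1, hq1, fun y h1 h2 => ?_, hz⟩⟩
    rw [hs]
    exact (mem_segment_fst_eq (by exact_mod_cast hlt.le)).2 ⟨rfl, h1, h2⟩
  choose xe hxe using hvert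
  have hlx_inj : ∀ u v, row u = row v → D.lx u = D.lx v → u = v := fun u v huv hx =>
    huniq u v (D.lx u) huv le_rfl (hlr u) hx.ge (hx ▸ hlr v)
  have hhor : ∀ e ∈ G.edgeSet, row (bot e) = row (top e) →
      D.rx (bot e) < D.lx (top e) ∧
      (∀ a, D.rx (bot e) ≤ a → a ≤ D.lx (top e) → (a, (row (bot e) : ℝ)) ∈ D.eseg e) ∧
      ∀ z, (z = D.ep1 e ∨ z = D.ep2 e) → z ∈ D.vseg (bot e) ∨ z ∈ D.vseg (top e) := by
    intro e he heq
    have hadj : G.Adj (bot e) (top e) := by rwa [hbt e] at he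
    have hlx : D.lx (bot e) ≤ D.lx (top e) := by
      rcases hord e with h | h
      · omega
      · exact h.2
    have hlt : D.rx (bot e) < D.lx (top e) := by
      by_contra! hle
      exact hadj.ne (huniq _ _ (D.lx (top e)) heq hlx hle le_rfl (hlr _))
    obtain ⟨⟨p1, p2⟩, ⟨q1, q2⟩, hp, hq, hs, -, hz⟩ := hE e he
    refine ⟨hlt, fun a h1 h2 => ?_, fun z hz' => ?_⟩
    · obtain ⟨h3, h4, h5⟩ := (hvseg _ _).1 hp
      obtain ⟨h6, h7, h8⟩ := (hvseg _ _).1 hq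
      simp only at h3 h4 h5 h6 h7 h8
      rw [hs, h3, h6, ← heq]
      exact (mem_segment_snd_eq (by linarith)).2
        ⟨rfl, by simp only; linarith, by simp only; linarith⟩
    · rcases hz z hz' with h | h
      · exact Or.inl (by rw [h]; exact hp)
      · exact Or.inr (by rw [h]; exact hq)
  let L : RowData V :=
    { row := row
      xpos := D.lx
      bot := bot
      top := top
      cross := fun k e => if row (bot e) = k then D.lx (bot e) else
        if row (top e) = k then D.lx (top e) else xe e
      mid := fun _ e => xe e }
  -- a rising edge meets the segments of its own ends only
  have hA : ∀ e k w, L.Meets G k e → row w = k → D.lx w ≤ xe e → xe e ≤ D.rx w → w ∈ e := by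
    intro e k w he hw h1 h2
    obtain ⟨hb, ht, hs, hz⟩ := hxe e he.mem he.lt
    have hb' : (row (bot e) : ℝ) ≤ k := by exact_mod_cast he.bot_le
    have ht' : (k : ℝ) ≤ row (top e) := by exact_mod_cast he.le_top
    have hp : (xe e, (k : ℝ)) ∈ D.eseg e ∩ D.vseg w :=
      ⟨hs k hb' ht', (hvseg _ _).2 ⟨by rw [hw], h1, h2⟩⟩
    rw [hmem]
    rcases hz _ (hev e he.mem w _ hp) with h | h
    · have : k = row (bot e) := Nat.cast_injective (R := ℝ) (congrArg Prod.snd h)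
      exact Or.inl (huniq _ _ _ (hw.trans this) h1 h2 hb.1 hb.2)
    · have : k = row (top e) := Nat.cast_injective (R := ℝ) (congrArg Prod.snd h)
      exact Or.inr (huniq _ _ _ (hw.trans this) h1 h2 ht.1 ht.2)
  have hC : ∀ e k, L.Meets G k e →
      (∃ w, w ∈ e ∧ row w = k ∧ L.cross k e = D.lx w ∧ D.lx w ≤ xe e ∧ xe e ≤ D.rx w) ∨
      (row (bot e) < k ∧ k < row (top e) ∧ L.cross k e = xe e) := by
    intro e k he
    obtain ⟨hb, ht, -⟩ := hxe e he.mem he.lt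
    have h1 : row (bot e) ≤ k := he.bot_le
    have h2 : k ≤ row (top e) := he.le_top
    simp only [L]
    split_ifs with h3 h4
    · exact Or.inl ⟨bot e, (hmem _ _).2 (Or.inl rfl), h3, rfl, hb⟩
    · exact Or.inl ⟨top e, (hmem _ _).2 (Or.inr rfl), h4, rfl, ht⟩
    · exact Or.inr ⟨by omega, by omega, rfl⟩
  have hinterior : ∀ e k w, row (bot e) < k → k < row (top e) → row w = k → w ∉ e := by
    intro e k w h1 h2 hw hwe
    rcases (hmem _ _).1 hwe with rfl | rfl <;> omega
  have hmono : ∀ e f k, L.Meets G k e → L.Meets G k f → xe e < xe f →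
      L.cross k e ≤ L.cross k f := by
    intro e f k he hf hlt
    rcases hC e k he with ⟨w, hw, hwk, h1, h2, h3⟩ | ⟨h1, h2, h3⟩ <;>
    rcases hC f k hf with ⟨w', hw', hwk', k1, k2, k3⟩ | ⟨k1, k2, k3⟩
    · rw [h1, k1]
      by_contra! hlt'
      obtain rfl := huniq w w' (D.lx w) (hwk.trans hwk'.symm) le_rfl (hlr w) hlt'.le
        (by linarith)
      exact lt_irrefl _ hlt'
    · rw [h1, k3]; linarith
    · rw [h3, k1]
      by_contra! hlt'
      exact hinterior e k w' h1 h2 hwk' (hA e k w' he hwk' hlt'.le (by linarith))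
    · rw [h3, k3]; exact hlt.le
  have hxx : ∀ e f, e ≠ f → ∀ k, L.Meets G k e → L.Meets G k f → ∀ y : ℝ,
      row (bot e) ≤ y → y ≤ row (top e) → row (bot f) ≤ y → y ≤ row (top f) → xe e = xe f →
      y = row (bot e) ∨ y = row (top e) := by
    intro e f hef k he hf y h1 h2 h3 h4 hx
    obtain ⟨-, -, hs, hz⟩ := hxe e he.mem he.lt
    obtain ⟨-, -, hs', -⟩ := hxe f hf.mem hf.lt
    have := (hee e he.mem f hf.mem hef (xe e, y) ⟨hs y h1 h2, hx ▸ hs' y h3 h4⟩).1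
    exact (hz _ this).imp (congrArg Prod.snd) (congrArg Prod.snd)
  have hhv : ∀ e ∈ G.edgeSet, row (bot e) = row (top e) → ∀ v, row v = row (bot e) →
      D.lx (bot e) ≤ D.lx v → D.lx v ≤ D.lx (top e) → v ∈ e := by
    intro e he heq v hv h1 h2
    obtain ⟨-, hs, hz⟩ := hhor e he heq
    rw [hmem]
    rcases le_total (D.lx v) (D.rx (bot e)) with h3 | h3
    · exact Or.inl (huniq _ _ _ hv le_rfl (hlr v) h1 h3)
    · have hp : (D.lx v, (row (bot e) : ℝ)) ∈ D.vseg v :=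
        (hvseg _ _).2 ⟨by rw [hv], le_rfl, hlr v⟩
      have hp' := hs _ h3 h2
      rcases hz _ (hev e he v _ ⟨hp', hp⟩) with h | h <;> obtain ⟨-, h4, h5⟩ := (hvseg _ _).1 h
      · exact Or.inl (huniq _ _ _ hv le_rfl (hlr v) h4 h5)
      · exact Or.inr (huniq _ _ _ (hv.trans heq) le_rfl (hlr v) h4 h5)
  refine ⟨L, ?_, fun v => (hrow v).symm⟩
  exact
    { one_le_row := hrow1
      row_le := hrowh
      eq_mk := fun e _ => hbt e
      bot_le_top := fun e _ => (hord e).elim le_of_lt (fun h => h.1.le)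
      xpos_inj := hlx_inj
      cross_bot := fun e k _ hk => if_pos hk
      cross_top := fun e k he hk => by
        have := he.lt
        have h' : row (bot e) ≠ k := by simp only [L] at this hk; omega
        simp only [L] at hk ⊢
        rw [if_neg h', if_pos hk]
      cross_eq := fun e f k he hf hef hx => by
        rcases hC e k he with ⟨w, hw, hwk, h1, h2, h3⟩ | ⟨h1, h2, h3⟩ <;>
        rcases hC f k hf with ⟨w', hw', hwk', k1, k2, k3⟩ | ⟨k1, k2, k3⟩
        · rw [h1, k1] at hx
          obtain rfl := hlx_inj w w' (hwk.trans hwk'.symm) hx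
          exact ⟨w, hw, hw', hwk⟩
        · rw [h1, k3] at hx
          exact ⟨w, hw, hA f k w hf hwk hx.le (hx ▸ hlr w), hwk⟩
        · rw [h3, k1] at hx
          exact ⟨w', hA e k w' he hwk' hx.ge (hx ▸ hlr w'), hw', hwk'⟩
        · rw [h3, k3] at hx
          have := hxx e f hef k he hf k (by exact_mod_cast h1.le) (by exact_mod_cast h2.le)
            (by exact_mod_cast k1.le) (by exact_mod_cast k2.le) hx
          norm_cast at this
          omega
      cross_eq_xpos := fun e k v he hv hx => by
        rcases hC e k he with ⟨w, hw, hwk, h1, h2, h3⟩ | ⟨h1, h2, h3⟩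
        · rw [h1] at hx
          obtain rfl := hlx_inj w v (hwk.trans hv.symm) hx
          exact hw
        · rw [h3] at hx
          exact hA e k v he hv hx.ge (by rw [hx]; exact hlr v)
      mid_ne := fun e f k he hf he' hf' hef hx => by
        have h1 : (row (bot e) : ℝ) ≤ k := by exact_mod_cast he.bot_le
        have h2 : (row (bot f) : ℝ) ≤ k := by exact_mod_cast hf.bot_le
        have h3 : ((k + 1 : ℕ) : ℝ) ≤ row (top e) := by exact_mod_cast he'.le_top
        have h4 : ((k + 1 : ℕ) : ℝ) ≤ row (top f) := by exact_mod_cast hf'.le_top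
        push_cast at h3 h4
        rcases hxx e f hef k he hf (k + 1 / 2) (by linarith) (by linarith) (by linarith)
          (by linarith) hx with h | h <;> linarith
      mid_lt := fun e f k he hf he' hf' hx => ⟨hmono e f k he hf hx, hmono e f _ he' hf' hx⟩
      hor_lt := fun e he heq => by
        have := (hhor e he heq).1
        exact (hlr _).trans_lt this
      hor_vert := hhv
      hor_cross := fun e he heq f hf h1 h2 => by
        have heq' : row (bot e) = row (top e) := heq
        rcases hC f _ hf with ⟨w, hw, hwk, k1, k2, k3⟩ | ⟨k1, k2, k3⟩
        · rw [k1] at h1 h2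
          exact ⟨w, hhv e he heq w hwk h1 h2, hw⟩
        · rw [k3] at h1 h2
          rcases le_total (xe f) (D.rx (bot e)) with h3 | h3
          · exact ⟨bot e, (hmem _ _).2 (Or.inl rfl), hA f _ (bot e) hf rfl h1 h3⟩
          obtain ⟨-, hs, hz⟩ := hhor e he heq
          obtain ⟨-, -, hs', -⟩ := hxe f hf.mem hf.lt
          have hef : e ≠ f := by
            rintro rfl
            exact hf.lt.ne heq
          have hp := hs' (row (bot e)) (by exact_mod_cast hf.bot_le) (by exact_mod_cast hf.le_top)
          rcases hz _ (hee e he f hf.mem hef _ ⟨hs _ h3 h2, hp⟩).1 with h | h <;>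
            obtain ⟨-, h4, h5⟩ := (hvseg _ _).1 h
          · exact ⟨bot e, (hmem _ _).2 (Or.inl rfl), hA f _ (bot e) hf rfl h4 h5⟩
          · exact ⟨top e, (hmem _ _).2 (Or.inr rfl), hA f _ (top e) hf heq.symm h4 h5⟩ }

theorem snd_le_of_mem_chainSet {s : ℝ} {l : List Pt} :
    ∀ {q : Pt}, (q :: l).IsChain (fun p q => s * p.2 ≤ s * q.2) →
      ∀ z ∈ chainSet (q :: l), s * q.2 ≤ s * z.2 := by
  induction l with
  | nil => rintro q - z rfl; exact le_rfl
  | cons r l ih =>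
    rintro q hq z (⟨a, b, ha, hb, hab, rfl⟩ | hz)
    · have h1 := (List.isChain_cons_cons.1 hq).1
      simp only [Prod.snd_add, Prod.smul_snd, smul_eq_mul]
      obtain rfl : a = 1 - b := by linarith
      nlinarith
    · exact (List.isChain_cons_cons.1 hq).1.trans (ih (List.isChain_cons_cons.1 hq).2 z hz)

theorem ordConnected_rowSlice_of_convex {S : Set Pt} (hS : Convex ℝ S) (y : ℝ) :
    (rowSlice S y).OrdConnected := by
  refine Convex.ordConnected (𝕜 := ℝ) fun x hx x' hx' a b ha hb hab => ?_
  have := hS hx hx' ha hb hab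
  simpa [rowSlice, ← add_mul, hab] using this

/-- A `y`-monotone chain meets every row in an interval. -/
theorem ordConnected_rowSlice_chainSet {s : ℝ} (hs : s ≠ 0) {l : List Pt}
    (hl : l.IsChain (fun p q => s * p.2 ≤ s * q.2)) (y : ℝ) :
    (rowSlice (chainSet l) y).OrdConnected := by
  induction l with
  | nil => simpa [rowSlice, chainSet] using ordConnected_empty
  | cons p l ih =>
    cases l with
    | nil => exact ordConnected_rowSlice_of_convex (convex_singleton p) y
    | cons q l =>
      obtain ⟨hpq, hl⟩ := List.isChain_cons_cons.1 hl
      have h1 := ordConnected_rowSlice_of_convex (convex_segment (𝕜 := ℝ) p q) y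
      have h2 := ih hl
      have hu : rowSlice (chainSet (p :: q :: l)) y =
        rowSlice (segment ℝ p q) y ∪ rowSlice (chainSet (q :: l)) y := rfl
      rcases lt_trichotomy (s * q.2) (s * y) with h | h | h
      · have : rowSlice (segment ℝ p q) y = ∅ := by
          refine eq_empty_of_forall_notMem fun x hx => ?_
          obtain ⟨a, b, ha, hb, hab, hx⟩ := hx
          have := congrArg Prod.snd hx
          simp only [Prod.snd_add, Prod.smul_snd, smul_eq_mul] at this
          obtain rfl : a = 1 - b := by linarith
          rw [← this] at h
          nlinarith
        rw [hu, this, empty_union]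
        exact h2
      · obtain rfl := mul_left_cancel₀ hs h
        rw [hu]
        refine isPreconnected_iff_ordConnected.1 (IsPreconnected.union q.1 ?_ ?_
          (isPreconnected_iff_ordConnected.2 h1) (isPreconnected_iff_ordConnected.2 h2))
        · exact right_mem_segment ℝ p q
        · cases l with
          | nil => rfl
          | cons r l => exact Or.inl (left_mem_segment ℝ q r)
      · have : rowSlice (chainSet (q :: l)) y = ∅ :=
          eq_empty_of_forall_notMem fun x hx => h.not_ge (snd_le_of_mem_chainSet hl _ hx)
        rw [hu, this, union_empty]
        exact h1

/-- A chain that starts in `S` and ends outside of `S` has a segment leaving `S`. -/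
theorem exists_segment_subset_chainSet (S : Set Pt) {l : List Pt} {a b : Pt}
    (ha : l.head? = some a) (hb : l.getLast? = some b) (haS : a ∈ S) (hbS : b ∉ S) :
    ∃ p ∈ l, ∃ q ∈ l, p ∈ S ∧ q ∉ S ∧ segment ℝ p q ⊆ chainSet l := by
  induction l generalizing a with
  | nil => simp at ha
  | cons p l ih =>
    obtain rfl : p = a := by simpa using ha
    cases l with
    | nil =>
      obtain rfl : p = b := by simpa using hb
      exact absurd haS hbS
    | cons q l =>
      by_cases hq : q ∈ S
      · obtain ⟨p', hp', q', hq', h1, h2, h3⟩ := ih rfl (by simpa using hb) hq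
        exact ⟨p', List.mem_cons_of_mem _ hp', q', List.mem_cons_of_mem _ hq', h1, h2,
          h3.trans subset_union_right⟩
      · exact ⟨p, by simp, q, by simp, haS, hq, subset_union_left⟩

theorem mem_chainBends_or_eq {l : List Pt} {a b p : Pt} (ha : l.head? = some a)
    (hb : l.getLast? = some b) (hp : p ∈ l) : p ∈ chainBends l ∨ p = a ∨ p = b := by
  cases l with
  | nil => simp at hp
  | cons c l =>
    obtain rfl : c = a := by simpa using ha
    rcases List.mem_cons.1 hp with rfl | hp
    · exact Or.inr (Or.inl rfl)
    have hne := List.ne_nil_of_mem hp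
    have hb' : l.getLast hne = b := by
      rw [List.getLast?_eq_some_getLast (by simp), List.getLast_cons hne] at hb
      exact Option.some_injective _ hb
    rw [← List.dropLast_append_getLast hne, hb'] at hp
    rcases List.mem_append.1 hp with hp | hp
    · exact Or.inl hp
    · exact Or.inr (Or.inr (by simpa using hp))

theorem exists_mem_segment_snd_eq {p q : Pt} {y : ℝ} (hpq : p.2 < q.2) (h1 : p.2 ≤ y)
    (h2 : y ≤ q.2) : ∃ a, (a, y) ∈ segment ℝ p q := by
  have hd : 0 < q.2 - p.2 := by linarith
  refine ⟨(1 - (y - p.2) / (q.2 - p.2)) * p.1 + (y - p.2) / (q.2 - p.2) * q.1,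
    1 - (y - p.2) / (q.2 - p.2), (y - p.2) / (q.2 - p.2), ?_, ?_, by ring, ?_⟩
  · rw [sub_nonneg, div_le_one hd]; linarith
  · exact div_nonneg (by linarith) hd.le
  · refine Prod.ext rfl ?_
    simp only [Prod.snd_add, Prod.smul_snd, smul_eq_mul]
    field_simp
    ring

/-- Every edge of a drawing of height `h` traverses the strip between two consecutive rows
along a segment, provided its ends lie on different sides of that strip. -/
theorem PolyDrawing.exists_segment_strip {V : Type} {G : SimpleGraph V} (Γ : PolyDrawing G)
    {h : ℕ} (hh : Γ.HasHeight h) {u v : V} (huv : G.Adj u v) {k : ℕ}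
    (hu : (Γ.pos u).2 ≤ k) (hv : (k + 1 : ℝ) ≤ (Γ.pos v).2) :
    ∃ a b : ℝ, segment ℝ ((a, (k : ℝ)) : Pt) (b, (k + 1 : ℝ)) ⊆ Γ.edgePts s(u, v) := by
  have key : ∃ p ∈ Γ.arc s(u, v), ∃ q ∈ Γ.arc s(u, v), p.2 ≤ k ∧ ¬ q.2 ≤ k ∧
      segment ℝ p q ⊆ Γ.edgePts s(u, v) := by
    rcases Γ.arc_ends u v huv with ⟨h1, h2⟩ | ⟨h1, h2⟩
    · exact exists_segment_subset_chainSet {p | p.2 ≤ k} h1 h2 hu (by simp; linarith)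
    · obtain ⟨p, hp, q, hq, h3, h4, h5⟩ :=
        exists_segment_subset_chainSet {p | ¬ p.2 ≤ k} h1 h2 (by simp; linarith) (by simpa using hu)
      exact ⟨q, hq, p, hp, by simpa using h4, h3, by rw [segment_symm]; exact h5⟩
  obtain ⟨p, -, q, hq, hpk, hqk, hpq⟩ := key
  have hcommon : ∃ n : ℕ, 1 ≤ n ∧ n ≤ h ∧ q.2 = n := by
    apply exists_nat_row
    have hq' : q ∈ chainBends (Γ.arc s(u, v)) ∨ q = Γ.pos u ∨ q = Γ.pos v := by
      rcases Γ.arc_ends u v huv with ⟨h1, h2⟩ | ⟨h1, h2⟩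
      · exact mem_chainBends_or_eq h1 h2 hq
      · exact (mem_chainBends_or_eq h1 h2 hq).imp_right Or.symm
    rcases hq' with hq' | rfl | rfl
    · exact hh.2 _ huv q hq'
    · exact hh.1 u
    · exact hh.1 v
  obtain ⟨n, -, -, hn⟩ := hcommon
  have hkn : (k + 1 : ℝ) ≤ q.2 := by
    rw [hn] at hqk ⊢
    norm_cast at hqk ⊢
    omega
  obtain ⟨a, ha⟩ := exists_mem_segment_snd_eq (y := k) (by linarith) hpk (by linarith : _ ≤ q.2)
  obtain ⟨b, hb⟩ := exists_mem_segment_snd_eq (p := p) (q := q) (y := k + 1) (by linarith)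
    (by linarith) hkn
  exact ⟨a, b, ((convex_segment p q).segment_subset ha hb).trans hpq⟩

theorem inter_nonempty_of_ordConnected {I J : Set ℝ} [I.OrdConnected] [J.OrdConnected]
    {a b c d : ℝ} (ha : a ∈ I) (hb : b ∈ J) (hc : c ∈ I) (hd : d ∈ J) (hab : a ≤ b)
    (hdc : d ≤ c) : (I ∩ J).Nonempty := by
  rcases le_total b c with h | h
  · exact ⟨b, Set.Icc_subset I ha hc ⟨hab, h⟩, hb⟩
  · exact ⟨c, hc, Set.Icc_subset J hd hb ⟨hdc, h⟩⟩

/-- An affine function without zeros in the interior of an interval that is negative at the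
midpoint is nonpositive at the ends. -/
theorem nonpos_of_affine_ne_zero {α β : ℝ} (h0 : ∀ θ ∈ Ioo (0 : ℝ) 1, (1 - θ) * α + θ * β ≠ 0)
    (hneg : α + β < 0) : α ≤ 0 ∧ β ≤ 0 := by
  constructor <;> by_contra! hpos
  · refine h0 (α / (α - β)) ⟨div_pos hpos (by linarith), ?_⟩ ?_
    · rw [div_lt_one (by linarith)]; linarith
    · have : α - β ≠ 0 := by linarith
      field_simp
      ring
  · refine h0 (α / (α - β)) ⟨div_pos_of_neg_of_neg (by linarith) (by linarith), ?_⟩ ?_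
    · rw [div_lt_one_of_neg (by linarith)]; linarith
    · have : α - β ≠ 0 := by linarith
      field_simp
      ring

open Classical in
/-- Every planar `y`-monotone drawing yields a layout. -/
theorem PolyDrawing.exists_layout {V : Type} {G : SimpleGraph V} (Γ : PolyDrawing G) {h : ℕ}
    (hp : Γ.IsPlanar) (hm : Γ.IsYMonotone) (hh : Γ.HasHeight h) :
    ∃ L : RowData V, L.IsLayout G h ∧ ∀ v, (L.row v : ℝ) = (Γ.pos v).2 := by
  choose row hrow1 hrowh hrow using fun v => exists_nat_row (hh.1 v)
  choose bot top hbt hord using exists_oriented_rep row (fun v => (Γ.pos v).1)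
  have hpos : ∀ v, Γ.pos v = ((Γ.pos v).1, (row v : ℝ)) := fun v => Prod.ext rfl (hrow v)
  have hmem : ∀ e w, w ∈ e ↔ w = bot e ∨ w = top e := by
    intro e w
    conv_lhs => rw [hbt e]
    exact Sym2.mem_iff
  have hadj : ∀ e ∈ G.edgeSet, G.Adj (bot e) (top e) := by
    intro e he
    rwa [hbt e] at he
  have hinj : ∀ u v, row u = row v → (Γ.pos u).1 = (Γ.pos v).1 → u = v := by
    intro u v h1 h2
    apply Γ.pos_inj
    rw [hpos u, hpos v, h1, h2]
  -- the trace of an edge in a row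
  let I : Sym2 V → ℕ → Set ℝ := fun e k => rowSlice (Γ.edgePts e) k
  have hI : ∀ e ∈ G.edgeSet, ∀ k, (I e k).OrdConnected := by
    intro e he k
    rcases hm e he with h1 | h1
    · exact ordConnected_rowSlice_chainSet (s := 1) one_ne_zero
        (by simpa using (List.isChain_map _).1 h1) k
    · exact ordConnected_rowSlice_chainSet (s := -1) (by norm_num)
        (by simpa using (List.isChain_map _).1 h1) k
  have hends : ∀ e ∈ G.edgeSet, ∀ w ∈ e, (Γ.pos w).1 ∈ I e (row w) := by
    intro e he w hw
    have hs := Γ.arc_simple _ _ (hadj e he)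
    rw [← hbt e] at hs
    change ((Γ.pos w).1, (row w : ℝ)) ∈ Γ.edgePts e
    rw [← hpos w]
    rcases (hmem e w).1 hw with rfl | rfl
    · exact hs.left_mem
    · exact hs.symm.left_mem
  have hIv : ∀ e ∈ G.edgeSet, ∀ v, (Γ.pos v).1 ∈ I e (row v) → v ∈ e := by
    intro e he v hv
    by_contra hve
    refine hp.1 v e he hve ?_
    rw [hpos v]
    exact hv
  have hIe : ∀ e ∈ G.edgeSet, ∀ f ∈ G.edgeSet, e ≠ f → ∀ k x, x ∈ I e k → x ∈ I f k →
      ∃ w, w ∈ e ∧ w ∈ f ∧ row w = k ∧ x = (Γ.pos w).1 := by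
    intro e he f hf hef k x hxe hxf
    obtain ⟨w, h1, h2, h3⟩ := hp.2 e he f hf hef (x, (k : ℝ)) ⟨hxe, hxf⟩
    rw [hpos w] at h3
    refine ⟨w, h1, h2, ?_, congrArg Prod.fst h3⟩
    exact (Nat.cast_injective (R := ℝ) (congrArg Prod.snd h3)).symm
  have hstrip : ∀ k e, ∃ a b : ℝ, e ∈ G.edgeSet → row (bot e) ≤ k → k + 1 ≤ row (top e) →
      segment ℝ ((a, (k : ℝ)) : Pt) (b, (k + 1 : ℝ)) ⊆ Γ.edgePts e := by
    intro k e
    by_cases hc : e ∈ G.edgeSet ∧ row (bot e) ≤ k ∧ k + 1 ≤ row (top e)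
    swap
    · exact ⟨0, 0, fun h1 h2 h3 => absurd ⟨h1, h2, h3⟩ hc⟩
    obtain ⟨he, h1, h2⟩ := hc
    obtain ⟨a, b, hab⟩ := Γ.exists_segment_strip hh (hadj e he) (k := k)
      (by rw [hrow]; exact_mod_cast h1) (by rw [hrow]; exact_mod_cast h2)
    rw [← hbt e] at hab
    exact ⟨a, b, fun _ _ _ => hab⟩
  choose lo hi hlohi using hstrip
  let L : RowData V :=
    { row := row
      xpos := fun v => (Γ.pos v).1
      bot := bot
      top := top
      cross := fun k e => if row (bot e) = k then (Γ.pos (bot e)).1 else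
        if row (top e) = k then (Γ.pos (top e)).1 else lo k e
      mid := fun k e => (lo k e + hi k e) / 2 }
  have hseg : ∀ e k, L.Meets G k e → L.Meets G (k + 1) e →
      segment ℝ ((lo k e, (k : ℝ)) : Pt) (hi k e, (k + 1 : ℝ)) ⊆ Γ.edgePts e :=
    fun e k h1 h2 => hlohi k e h1.mem h1.bot_le h2.le_top
  have hlo : ∀ e k, L.Meets G k e → L.Meets G (k + 1) e → lo k e ∈ I e k :=
    fun e k h1 h2 => hseg e k h1 h2 (left_mem_segment ℝ _ _)
  have hhi : ∀ e k, L.Meets G k e → L.Meets G (k + 1) e → hi k e ∈ I e (k + 1) := by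
    intro e k h1 h2
    have := hseg e k h1 h2 (right_mem_segment ℝ _ _)
    simpa [I, rowSlice] using this
  have hcross_mem : ∀ e k, L.Meets G k e → ∀ w, w ∈ e → row w = k →
      L.cross k e = (Γ.pos w).1 := by
    intro e k he w hw hwk
    have hlt : row (bot e) < row (top e) := he.lt
    simp only [L]
    rcases (hmem e w).1 hw with rfl | rfl
    · rw [if_pos hwk]
    · rw [if_neg (by omega), if_pos hwk]
  have hcross : ∀ e k, L.Meets G k e → L.cross k e ∈ I e k := by
    intro e k he
    have h1 : row (bot e) ≤ k := he.bot_le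
    have h2 : k ≤ row (top e) := he.le_top
    simp only [L]
    split_ifs with h3 h4
    · rw [← h3]; exact hends e he.mem _ ((hmem _ _).2 (Or.inl rfl))
    · rw [← h4]; exact hends e he.mem _ ((hmem _ _).2 (Or.inr rfl))
    · exact hlohi k e he.mem h1 (by omega) (left_mem_segment ℝ _ _)
  have hne : ∀ e f k, L.Meets G k e → L.Meets G k f → L.Meets G (k + 1) e →
      L.Meets G (k + 1) f → e ≠ f → ∀ θ ∈ Ioo (0 : ℝ) 1,
      (1 - θ) * lo k e + θ * hi k e ≠ (1 - θ) * lo k f + θ * hi k f := by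
    intro e f k he hf he' hf' hef θ hθ heq
    have aux : ∀ g, L.Meets G k g → L.Meets G (k + 1) g →
        ((1 - θ) * lo k g + θ * hi k g, (k + θ : ℝ)) ∈ Γ.edgePts g := by
      intro g h1 h2
      refine hseg g k h1 h2 ⟨1 - θ, θ, by linarith [hθ.2], hθ.1.le, by ring, ?_⟩
      refine Prod.ext rfl ?_
      simp only [Prod.snd_add, Prod.smul_snd, smul_eq_mul]
      ring
    obtain ⟨w, -, -, hw⟩ := hp.2 e he.mem f hf.mem hef _ ⟨aux e he he', heq ▸ aux f hf hf'⟩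
    have hw2 : (k + θ : ℝ) = row w := by rw [← hrow, ← hw]
    have h1 : (k : ℝ) < row w := by linarith [hθ.1]
    have h2 : (row w : ℝ) < k + 1 := by linarith [hθ.2]
    norm_cast at h1 h2
    omega
  have hle : ∀ e f k, L.Meets G k e → L.Meets G k f → e ≠ f → ∀ a ∈ I e k, ∀ b ∈ I f k,
      a ≤ b → L.cross k e ≤ L.cross k f := by
    intro e f k he hf hef a ha b hb hab
    by_contra! hlt
    have := hI e he.mem k
    have := hI f hf.mem k
    obtain ⟨x, hx1, hx2⟩ :=
      inter_nonempty_of_ordConnected ha hb (hcross e k he) (hcross f k hf) hab hlt.le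
    obtain ⟨w, h1, h2, h3, -⟩ := hIe e he.mem f hf.mem hef k x hx1 hx2
    rw [hcross_mem e k he w h1 h3, hcross_mem f k hf w h2 h3] at hlt
    exact lt_irrefl _ hlt
  have hhor : ∀ e ∈ G.edgeSet, row (bot e) = row (top e) → ∀ x, (Γ.pos (bot e)).1 ≤ x →
      x ≤ (Γ.pos (top e)).1 → x ∈ I e (row (bot e)) := by
    intro e he heq x h1 h2
    have h3 := hends e he (top e) ((hmem _ _).2 (Or.inr rfl))
    rw [← heq] at h3
    exact (hI e he _).out (hends e he _ ((hmem _ _).2 (Or.inl rfl))) h3 ⟨h1, h2⟩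
  refine ⟨L, ?_, fun v => (hrow v).symm⟩
  exact
    { one_le_row := hrow1
      row_le := hrowh
      eq_mk := fun e _ => hbt e
      bot_le_top := fun e _ => (hord e).elim le_of_lt (fun h => h.1.le)
      xpos_inj := hinj
      cross_bot := fun e k he hk => hcross_mem e k he _ ((hmem _ _).2 (Or.inl rfl)) hk
      cross_top := fun e k he hk => hcross_mem e k he _ ((hmem _ _).2 (Or.inr rfl)) hk
      cross_eq := fun e f k he hf hef hx => by
        obtain ⟨w, h1, h2, h3, -⟩ :=
          hIe e he.mem f hf.mem hef k _ (hcross e k he) (hx ▸ hcross f k hf)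
        exact ⟨w, h1, h2, h3⟩
      cross_eq_xpos := fun e k v he hv hx => by
        refine hIv e he.mem v ?_
        have := hcross e k he
        rw [hx, ← hv] at this
        exact this
      mid_ne := fun e f k he hf he' hf' hef hx => by
        refine hne e f k he hf he' hf' hef (1 / 2) ⟨by norm_num, by norm_num⟩ ?_
        simp only [L] at hx
        linarith
      mid_lt := fun e f k he hf he' hf' hx => by
        have hef : e ≠ f := by
          rintro rfl
          exact lt_irrefl _ hx
        simp only [L] at hx
        obtain ⟨h1, h2⟩ := nonpos_of_affine_ne_zero (α := lo k e - lo k f)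
          (β := hi k e - hi k f)
          (fun θ hθ h0 => hne e f k he hf he' hf' hef θ hθ (by linarith)) (by linarith)
        exact ⟨hle e f k he hf hef _ (hlo e k he he') _ (hlo f k hf hf') (by linarith),
          hle e f (k + 1) he' hf' hef _ (hhi e k he he') _ (hhi f k hf hf') (by linarith)⟩
      hor_lt := fun e he heq => by
        have heq' : row (bot e) = row (top e) := heq
        have h1 : (Γ.pos (bot e)).1 ≤ (Γ.pos (top e)).1 := by
          rcases hord e with h | h
          · omega
          · exact h.2
        exact h1.lt_of_ne fun h2 => (hadj e he).ne (hinj _ _ heq' h2)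
      hor_vert := fun e he heq v hv h1 h2 => by
        have hv' : row v = row (bot e) := hv
        refine hIv e he v ?_
        rw [hv']
        exact hhor e he heq _ h1 h2
      hor_cross := fun e he heq f hf h1 h2 => by
        have hef : e ≠ f := by
          rintro rfl
          exact hf.lt.ne heq
        obtain ⟨w, h3, h4, -⟩ := hIe e he f hf.mem hef _ _ (hhor e he heq _ h1 h2)
          (hcross f _ hf)
        exact ⟨w, h3, h4⟩ }

/-- Flat visibility representations and `y`-monotone poly-line
drawings are equivalent height-for-height, preserving the `y`-coordinate of every
vertex in both directions. -/
theorem stmt18 {V : Type} [Fintype V] (G : SimpleGraph V) (h : ℕ) :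
    (∀ D : VisData V, IsFlatVisRep G D h →
      ∃ Γ : PolyDrawing G, Γ.IsPlanar ∧ Γ.IsYMonotone ∧ Γ.HasHeight h ∧
        ∀ v : V, (Γ.pos v).2 = D.ly v) ∧
    (∀ Γ : PolyDrawing G, Γ.IsPlanar → Γ.IsYMonotone → Γ.HasHeight h →
      ∃ D : VisData V, IsFlatVisRep G D h ∧ ∀ v : V, D.ly v = (Γ.pos v).2) := by
  refine ⟨fun D hD => ?_, fun Γ hp hm hh => ?_⟩
  · obtain ⟨L, hL, hrow⟩ := hD.exists_layout
    obtain ⟨Γ, hp, hm, hh, hy⟩ := hL.exists_polyDrawing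
    exact ⟨Γ, hp, hm, hh, fun v => (hy v).trans (hrow v)⟩
  · obtain ⟨L, hL, hrow⟩ := Γ.exists_layout hp hm hh
    obtain ⟨D, hD, hy⟩ := hL.exists_flatVisRep
    exact ⟨D, hD, fun v => (hy v).trans (hrow v)⟩
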